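/- arXiv:astro-ph/0501541 — 3 statements merged into one kernel-verified Lean document; each statement's English description precedes it below -/
import Mathlib

section
/- Let ρ₀ ∈ R_M be a minimizer of the reduced functional H_r, with potential U₀(x) = -∫ ρ₀(y)/|x-y| dy. Then there exists a Lagrange multiplier E₀ ∈ ℝ such that almost everywhere: where U₀(x) < E₀ one has ρ₀(x) > 0 and Ψ'(ρ₀(x)) = E₀ - U₀(x) (i.e. ρ₀ = (Ψ')⁻¹(E₀ - U₀)), and where U₀(x) ≥ E₀ one has ρ₀(x) = 0. -/
open MeasureTheory Filter Topology Set ENNReal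

noncomputable section

/-- Physical space `ℝ³`. -/
abbrev R3 : Type := EuclideanSpace ℝ (Fin 3)

/-- Spatial density `ρ_f(x) = ∫ f(x,v) dv` induced by a phase-space density. -/
def spatialDensity (f : R3 × R3 → ℝ) (x : R3) : ℝ := ∫ v, f (x, v)

/-- Kinetic energy `E_kin(f) = (1/2)∫∫ |v|² f dv dx`. -/
def Ekin (f : R3 × R3 → ℝ) : ℝ := (1/2) * ∫ p : R3 × R3, ‖p.2‖ ^ 2 * f p

/-- `D(σ) = ∫∫ σ(x)σ(y)/|x-y| dx dy`. -/
def Dpair (σ : R3 → ℝ) : ℝ := ∫ x, ∫ y, σ x * σ y / ‖x - y‖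

/-- Potential energy `E_pot(ρ) = -(1/2)∫∫ ρ(x)ρ(y)/|x-y| dx dy`. -/
def Epot (ρ : R3 → ℝ) : ℝ := -(1/2) * Dpair ρ

/-- Casimir functional `C(f) = ∫∫ Φ(f) dv dx`. -/
def Casimir (Φ : ℝ → ℝ) (f : R3 × R3 → ℝ) : ℝ := ∫ p, Φ (f p)

/-- Energy-Casimir functional `H_C = E_kin + E_pot + C`. -/
def HC (Φ : ℝ → ℝ) (f : R3 × R3 → ℝ) : ℝ :=
  Ekin f + Epot (spatialDensity f) + Casimir Φ f

/-- Membership in the constraint set `F_M`. -/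
structure MemFM (Φ : ℝ → ℝ) (M : ℝ) (f : R3 × R3 → ℝ) : Prop where
  nonneg : ∀ p, 0 ≤ f p
  integrable : Integrable f
  mass : (∫ p, f p) = M
  kin_int : Integrable (fun p : R3 × R3 => ‖p.2‖ ^ 2 * f p)
  cas_int : Integrable (fun p => Φ (f p))

/-- The constraint set `F_M`. -/
def FMset (Φ : ℝ → ℝ) (M : ℝ) : Set ((R3 × R3) → ℝ) := {f | MemFM Φ M f}

/-- Hypotheses (Φ1)-(Φ3) on the Casimir function `Φ`, with derivative `Φ'`
and growth exponents `k`, `k'`. -/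
structure IsPhi (Φ Φ' : ℝ → ℝ) (k k' : ℝ) : Prop where
  zero : Φ 0 = 0
  deriv_zero : Φ' 0 = 0
  hasDeriv : ∀ s ∈ Ici (0:ℝ), HasDerivAt Φ (Φ' s) s
  derivCont : ContinuousOn Φ' (Ici 0)
  nonneg : ∀ s ∈ Ici (0:ℝ), 0 ≤ Φ s
  sconvex : StrictConvexOn ℝ (Ici 0) Φ
  k_pos : 0 < k
  k_lt : k < 3/2
  k'_pos : 0 < k'
  k'_lt : k' < 3/2
  growth_large : ∃ C > 0, ∃ F₁ > 0, ∀ s, F₁ ≤ s → C * s ^ (1 + 1/k) ≤ Φ s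
  growth_small : ∃ C > 0, ∃ F₂ > 0, ∀ s, 0 ≤ s → s ≤ F₂ → Φ s ≤ C * s ^ (1 + 1/k')

/-- Potential `U_ρ(x) = -∫ ρ(y)/|x-y| dy` induced by a spatial density. -/
def U0rho (ρ : R3 → ℝ) (x : R3) : ℝ := -∫ y, ρ y / ‖x - y‖

/-- Particle energy `E(x,v) = (1/2)|v|² + U₀(x)` for the state `f₀`. -/
def Epart (f₀ : R3 × R3 → ℝ) (p : R3 × R3) : ℝ :=
  (1/2) * ‖p.2‖ ^ 2 + U0rho (spatialDensity f₀) p.1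

/-- Reduced density function `Ψ(s)`, obtained from `Φ` by minimizing the sum of kinetic
energy density and Casimir density over all velocity profiles of total mass `s`. -/
def PsiOf (Φ : ℝ → ℝ) (s : ℝ) : ℝ :=
  sInf { r : ℝ | ∃ g : R3 → ℝ, (∀ v, 0 ≤ g v) ∧ Integrable g ∧ (∫ v, g v) = s ∧
    Integrable (fun v => (1/2) * ‖v‖ ^ 2 * g v + Φ (g v)) ∧
    r = ∫ v, ((1/2) * ‖v‖ ^ 2 * g v + Φ (g v)) }

/-- Reduced functional `H_r(ρ) = ∫ Ψ(ρ) dx + E_pot(ρ)`. -/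
def Hr (Ψ : ℝ → ℝ) (ρ : R3 → ℝ) : ℝ := (∫ x, Ψ (ρ x)) + Epot ρ

/-- Membership in the reduced constraint set `R_M`. -/
structure MemRM (Ψ : ℝ → ℝ) (M : ℝ) (ρ : R3 → ℝ) : Prop where
  nonneg : ∀ x, 0 ≤ ρ x
  integrable : Integrable ρ
  mass : (∫ x, ρ x) = M
  psi_int : Integrable (fun x => Ψ (ρ x))

/-- The reduced constraint set `R_M`. -/
def RMset (Ψ : ℝ → ℝ) (M : ℝ) : Set (R3 → ℝ) := {ρ | MemRM Ψ M ρ}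

/-- Hypotheses (Ψ1)-(Ψ3) on `Ψ`, with derivative `Ψ'` and growth exponents `n`, `n'`. -/
structure IsPsi (Ψ Ψ' : ℝ → ℝ) (n n' : ℝ) : Prop where
  zero : Ψ 0 = 0
  deriv_zero : Ψ' 0 = 0
  hasDeriv : ∀ s ∈ Ici (0:ℝ), HasDerivAt Ψ (Ψ' s) s
  derivCont : ContinuousOn Ψ' (Ici 0)
  nonneg : ∀ s ∈ Ici (0:ℝ), 0 ≤ Ψ s
  sconvex : StrictConvexOn ℝ (Ici 0) Ψ
  n_pos : 0 < n
  n_lt : n < 3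
  n'_pos : 0 < n'
  n'_lt : n' < 3
  growth_large : ∃ C > 0, ∃ s₁ > 0, ∀ s, s₁ ≤ s → C * s ^ (1 + 1/n) ≤ Ψ s
  growth_small : ∃ C > 0, ∃ s₂ > 0, ∀ s, 0 ≤ s → s ≤ s₂ → Ψ s ≤ C * s ^ (1 + 1/n')

/-- Relative "distance" `d(f,f₀) = ∫∫ [Φ(f) - Φ(f₀) + E (f - f₀)] dv dx`. -/
def dVP (Φ : ℝ → ℝ) (f₀ f : R3 × R3 → ℝ) : ℝ :=
  ∫ p, (Φ (f p) - Φ (f₀ p) + Epart f₀ p * (f p - f₀ p))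


lemma kern_sq_integrable :
    Integrable (fun z : R3 => (Metric.ball (0:R3) 1).indicator (fun z => (‖z‖⁻¹) ^ 2) z) := by
  rw [integrable_indicator_iff measurableSet_ball]
  have := (integrableOn_fun_norm_addHaar (volume : Measure R3) (f := fun t : ℝ => (t⁻¹)^2) (r := 1)).2
  apply this
  have h : IntegrableOn (fun _ : ℝ => (1:ℝ)) (Ioo (0:ℝ) 1) := by
    simp
  refine h.congr_fun (fun t ht => ?_) measurableSet_Ioo
  have : t ≠ 0 := ht.1.ne'
  simp
  field_simp

/-- `|u|^{4/3}`. -/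
def q43 (u : ℝ) : ℝ := (|u| ^ (1/3:ℝ)) ^ 4

lemma q43_nonneg (u : ℝ) : 0 ≤ q43 u := by unfold q43; positivity

lemma cube_q (u : ℝ) : (|u| ^ (1/3:ℝ)) ^ 3 = |u| := by
  rw [← Real.rpow_natCast, ← Real.rpow_mul (abs_nonneg u)]; norm_num

lemma kern_pointwise (u v t : ℝ) :
    |u| * |v| * t ≤ 1/2 * (q43 u * q43 v) + 1/4 * (q43 u * t^2) + 1/4 * (q43 v * t^2) := by
  have hu := cube_q u
  have hv := cube_q v
  unfold q43
  set a := |u| ^ (1/3:ℝ)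
  set b := |v| ^ (1/3:ℝ)
  rw [← hu, ← hv]
  nlinarith [sq_nonneg (a^2*b^2 - a*b*t), mul_nonneg (sq_nonneg (a^2-b^2)) (sq_nonneg t)]

lemma prod_integrable {f g : R3 → ℝ} (hf : Integrable f) (hg : Integrable g)
    (hf' : Integrable (fun x => q43 (f x))) (hg' : Integrable (fun x => q43 (g x))) :
    Integrable (fun p : R3 × R3 => f p.1 * g p.2 / ‖p.1 - p.2‖) (volume.prod volume) := by
  have hk := kern_sq_integrable
  set h : R3 → ℝ := (Metric.ball (0:R3) 1).indicator (fun z => (‖z‖⁻¹) ^ 2) with hh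
  have i1 := (hf.abs.mul_prod hg.abs)
  have i2 := (hf'.mul_prod hg')
  have i3 : Integrable (fun p : R3 × R3 => q43 (g p.2) * h (p.1 - p.2)) (volume.prod volume) :=
    hg'.convolution_integrand (ContinuousLinearMap.mul ℝ ℝ) hk
  have i4 : Integrable (fun p : R3 × R3 => q43 (f p.1) * h (p.1 - p.2)) (volume.prod volume) := by
    have := (hf'.convolution_integrand (ContinuousLinearMap.mul ℝ ℝ) hk).swap
    refine this.congr (ae_of_all _ fun p => ?_)
    simp only [Function.comp, Prod.swap, ContinuousLinearMap.mul_apply', hh, indicator, Metric.mem_ball,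
      dist_zero_right, norm_sub_rev p.2 p.1]
  have i5 := ((i1.add (i2.const_mul (1/2))).add (i4.const_mul (1/4))).add (i3.const_mul (1/4))
  refine i5.mono' ?_ (ae_of_all _ fun p => ?_)
  · have m1 : AEStronglyMeasurable (fun p : R3 × R3 => f p.1 * g p.2) (volume.prod volume) :=
      (hf.mul_prod hg).aestronglyMeasurable
    have m2 : Measurable (fun p : R3 × R3 => ‖p.1 - p.2‖⁻¹) := by fun_prop
    simp only [div_eq_mul_inv]
    exact m1.mul m2.aestronglyMeasurable
  · simp only [Pi.add_apply]
    rw [Real.norm_eq_abs, abs_div, abs_mul, abs_norm, div_eq_mul_inv]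
    have hq1 := q43_nonneg (f p.1)
    have hq2 := q43_nonneg (g p.2)
    by_cases hz : ‖p.1 - p.2‖ < 1
    · have : h (p.1 - p.2) = (‖p.1 - p.2‖⁻¹)^2 := by
        rw [hh, indicator_of_mem]; simpa using hz
      rw [this]
      have := kern_pointwise (f p.1) (g p.2) (‖p.1 - p.2‖⁻¹)
      have : 0 ≤ |f p.1| * |g p.2| := by positivity
      linarith
    · have h0 : h (p.1 - p.2) = 0 := by
        rw [hh, indicator_of_notMem]; simpa using hz
      rw [h0]
      have h1 : ‖p.1 - p.2‖⁻¹ ≤ 1 := inv_le_one_of_one_le₀ (not_lt.1 hz)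
      have : |f p.1| * |g p.2| * ‖p.1 - p.2‖⁻¹ ≤ |f p.1| * |g p.2| :=
        mul_le_of_le_one_right (by positivity) h1
      have := mul_nonneg hq1 hq2
      linarith

lemma psi_q43 {Ψ Ψ' : ℝ → ℝ} {n n' : ℝ} (hΨ : IsPsi Ψ Ψ' n n') :
    ∃ A : ℝ, ∀ s, 0 ≤ s → q43 s ≤ A * (s + Ψ s) := by
  obtain ⟨C, hC, s₁, hs₁, hg⟩ := hΨ.growth_large
  set S := max s₁ 1
  refine ⟨S + 1/C, fun s hs => ?_⟩
  have hP := hΨ.nonneg s hs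
  have hS1 : 1 ≤ S := le_max_right _ _
  have hcube := cube_q s
  have hCi : 0 < 1/C := by positivity
  rw [abs_of_nonneg hs] at hcube
  by_cases h : s ≤ S
  · have : s ^ (1/3:ℝ) ≤ S := by
      calc s ^ (1/3:ℝ) ≤ S ^ (1/3:ℝ) := Real.rpow_le_rpow hs h (by norm_num)
        _ ≤ S ^ (1:ℝ) := Real.rpow_le_rpow_of_exponent_le hS1 (by norm_num)
        _ = S := Real.rpow_one S
    have e : q43 s = s ^ (1/3:ℝ) * s := by
      unfold q43; rw [abs_of_nonneg hs, pow_succ, hcube, mul_comm]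
    rw [e]
    nlinarith [mul_le_mul_of_nonneg_right this hs, mul_nonneg hCi.le hs, mul_nonneg hCi.le hP]
  · push Not at h
    have h1 : 1 ≤ s := hS1.trans h.le
    have := hg s ((le_max_left _ _).trans h.le)
    have e : q43 s = s ^ (4/3:ℝ) := by
      unfold q43; rw [abs_of_nonneg hs, ← Real.rpow_natCast, ← Real.rpow_mul hs]; norm_num
    have hn : (4/3:ℝ) ≤ 1 + 1/n := by
      have : 1/3 ≤ 1/n := one_div_le_one_div_of_le hΨ.n_pos hΨ.n_lt.le
      linarith
    have h2 : s ^ (4/3:ℝ) ≤ s ^ (1+1/n) := Real.rpow_le_rpow_of_exponent_le h1 hn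
    rw [e]
    have h3 : s ^ (1+1/n) ≤ 1/C * Ψ s := by
      rw [one_div C, le_inv_mul_iff₀ hC]; exact this
    nlinarith [mul_nonneg hCi.le hs]

lemma q43_continuous : Continuous q43 := by
  unfold q43
  exact ((continuous_abs).rpow_const (fun _ => Or.inr (by norm_num))).pow 4

lemma sigmaU_integrable {ρ σ : R3 → ℝ} (hρ : Integrable ρ) (hσ : Integrable σ)
    (hρ' : Integrable (fun x => q43 (ρ x))) (hσ' : Integrable (fun x => q43 (σ x))) :
    Integrable (fun x => σ x * U0rho ρ x) := by
  have h := (prod_integrable hσ hρ hσ' hρ').integral_prod_left.neg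
  refine h.congr (ae_of_all _ fun x => ?_)
  simp only [Pi.neg_apply, U0rho, mul_div_assoc, integral_const_mul, mul_neg]

lemma sigmaU_integral {ρ σ : R3 → ℝ} (hρ : Integrable ρ) (hσ : Integrable σ)
    (hρ' : Integrable (fun x => q43 (ρ x))) (hσ' : Integrable (fun x => q43 (σ x))) :
    (∫ p : R3 × R3, σ p.1 * ρ p.2 / ‖p.1 - p.2‖ ∂(volume.prod volume))
      = - ∫ x, σ x * U0rho ρ x := by
  rw [integral_prod _ (prod_integrable hσ hρ hσ' hρ'), ← integral_neg]
  simp only [U0rho, mul_div_assoc, integral_const_mul, mul_neg, neg_neg]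

lemma Dpair_expand {ρ σ : R3 → ℝ} (hρ : Integrable ρ) (hσ : Integrable σ)
    (hρ' : Integrable (fun x => q43 (ρ x))) (hσ' : Integrable (fun x => q43 (σ x))) (ε : ℝ) :
    Dpair (fun x => ρ x + ε * σ x) =
      Dpair ρ - 2 * ε * (∫ x, σ x * U0rho ρ x) + ε ^ 2 * Dpair σ := by
  have i1 := prod_integrable hρ hρ hρ' hρ'
  have i2 := prod_integrable hρ hσ hρ' hσ'
  have i3 := prod_integrable hσ hρ hσ' hρ'
  have i4 := prod_integrable hσ hσ hσ' hσ'
  have e1 : Dpair ρ = _ := (integral_prod _ i1).symm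
  have e4 : Dpair σ = _ := (integral_prod _ i4).symm
  have e3 := sigmaU_integral hρ hσ hρ' hσ'
  have e2 : (∫ p : R3 × R3, ρ p.1 * σ p.2 / ‖p.1 - p.2‖ ∂(volume.prod volume))
      = - ∫ x, σ x * U0rho ρ x := by
    rw [← e3, ← integral_prod_swap]
    congr 1
    ext p
    simp only [Prod.fst_swap, Prod.snd_swap, norm_sub_rev p.2 p.1, mul_comm (ρ p.2)]
  have i5 := ((i1.add (i2.const_mul ε)).add (i3.const_mul ε)).add (i4.const_mul (ε^2))
  have e : (fun p : R3 × R3 => (ρ p.1 + ε * σ p.1) * (ρ p.2 + ε * σ p.2) / ‖p.1 - p.2‖) =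
      fun p : R3 × R3 => ρ p.1 * ρ p.2 / ‖p.1 - p.2‖ + ε * (ρ p.1 * σ p.2 / ‖p.1 - p.2‖)
      + ε * (σ p.1 * ρ p.2 / ‖p.1 - p.2‖) + ε^2 * (σ p.1 * σ p.2 / ‖p.1 - p.2‖) := by
    ext p; ring
  have e5 : Dpair (fun x => ρ x + ε * σ x) =
      ∫ p : R3 × R3, (ρ p.1 + ε * σ p.1) * (ρ p.2 + ε * σ p.2) / ‖p.1 - p.2‖
        ∂(volume.prod volume) := by
    have i6 : Integrable (fun p : R3 × R3 =>
        (ρ p.1 + ε * σ p.1) * (ρ p.2 + ε * σ p.2) / ‖p.1 - p.2‖) (volume.prod volume) := by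
      rw [e]; exact i5
    exact (integral_prod _ i6).symm
  have j2 : Integrable (fun p : R3 × R3 => ρ p.1 * ρ p.2 / ‖p.1 - p.2‖
      + ε * (ρ p.1 * σ p.2 / ‖p.1 - p.2‖)) (volume.prod volume) := i1.add (i2.const_mul ε)
  have j3 : Integrable (fun p : R3 × R3 => ρ p.1 * ρ p.2 / ‖p.1 - p.2‖
      + ε * (ρ p.1 * σ p.2 / ‖p.1 - p.2‖) + ε * (σ p.1 * ρ p.2 / ‖p.1 - p.2‖))
      (volume.prod volume) := j2.add (i3.const_mul ε)
  rw [e5, e, integral_add j3 (i4.const_mul (ε^2)),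
    integral_add j2 (i3.const_mul ε), integral_add i1 (i2.const_mul ε)]
  simp only [integral_const_mul]
  rw [e2, e3, e1, e4]
  ring

lemma psi_conv {Ψ Ψ' : ℝ → ℝ} {n n' : ℝ} (hΨ : IsPsi Ψ Ψ' n n') {s t : ℝ} (hs : 0 ≤ s)
    (ht : 0 ≤ t) : Ψ t - Ψ s ≤ Ψ' t * (t - s) := by
  have hc := hΨ.sconvex.convexOn
  rcases lt_trichotomy s t with h | h | h
  · have := hc.slope_le_of_hasDerivAt hs ht h (hΨ.hasDeriv t ht)
    rw [slope_def_field, div_le_iff₀ (by linarith)] at this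
    exact this
  · subst h; simp
  · have := hc.le_slope_of_hasDerivAt ht hs h (hΨ.hasDeriv t ht)
    rw [slope_def_field, le_div_iff₀ (by linarith)] at this
    linarith

lemma psi_mono {Ψ Ψ' : ℝ → ℝ} {n n' : ℝ} (hΨ : IsPsi Ψ Ψ' n n') {s t : ℝ} (hs : 0 ≤ s)
    (h : s ≤ t) : Ψ' s ≤ Ψ' t := by
  rcases h.eq_or_lt with h | h
  · rw [h]
  have h1 := psi_conv hΨ hs (hs.trans h.le)
  have h2 := psi_conv hΨ (hs.trans h.le) hs
  by_contra hh
  push Not at hh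
  nlinarith

lemma psi_pos {Ψ Ψ' : ℝ → ℝ} {n n' : ℝ} (hΨ : IsPsi Ψ Ψ' n n') {s : ℝ} (hs : 0 < s) :
    0 < Ψ' s := by
  have := hΨ.sconvex.slope_lt_of_hasDerivAt (x := 0) (y := s) (mem_Ici.2 le_rfl) hs.le hs
    (hΨ.hasDeriv s hs.le)
  refine lt_of_le_of_lt ?_ this
  rw [slope_def_field, hΨ.zero]
  have := hΨ.nonneg s hs.le
  simp only [sub_zero]
  positivity

lemma psi_nonneg {Ψ Ψ' : ℝ → ℝ} {n n' : ℝ} (hΨ : IsPsi Ψ Ψ' n n') {s : ℝ} (hs : 0 ≤ s) :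
    0 ≤ Ψ' s := by
  have := psi_mono hΨ le_rfl hs
  rwa [hΨ.deriv_zero] at this

lemma psi_lip {Ψ Ψ' : ℝ → ℝ} {n n' : ℝ} (hΨ : IsPsi Ψ Ψ' n n') {s t K : ℝ} (hs : 0 ≤ s)
    (ht : 0 ≤ t) (hsK : s ≤ K) (htK : t ≤ K) : |Ψ t - Ψ s| ≤ Ψ' K * |t - s| := by
  have h1 := psi_conv hΨ hs ht
  have h2 := psi_conv hΨ ht hs
  have m1 := psi_mono hΨ hs hsK
  have m2 := psi_mono hΨ ht htK
  have n1 := psi_nonneg hΨ hs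
  have n2 := psi_nonneg hΨ ht
  have a1 : Ψ' t * (t - s) ≤ Ψ' K * |t - s| :=
    calc Ψ' t * (t - s) ≤ Ψ' t * |t - s| := mul_le_mul_of_nonneg_left (le_abs_self _) n2
      _ ≤ _ := mul_le_mul_of_nonneg_right m2 (abs_nonneg _)
  have a2 : Ψ' s * (s - t) ≤ Ψ' K * |t - s| := by
    calc Ψ' s * (s - t) ≤ Ψ' s * |t - s| :=
          mul_le_mul_of_nonneg_left (by rw [abs_sub_comm]; exact le_abs_self _) n1
      _ ≤ _ := mul_le_mul_of_nonneg_right m1 (abs_nonneg _)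
  rw [abs_le]
  constructor <;> linarith

lemma ext_continuous {F : ℝ → ℝ} (hF : ContinuousOn F (Ici 0)) :
    Continuous (fun t => F (max t 0)) :=
  hF.comp_continuous (continuous_id.max continuous_const) (fun t => le_max_right t 0)

lemma comp_aesm {F : ℝ → ℝ} (hF : ContinuousOn F (Ici 0)) {ρ : R3 → ℝ}
    (hρ : AEStronglyMeasurable ρ) (h0 : ∀ x, 0 ≤ ρ x) :
    AEStronglyMeasurable (fun x => F (ρ x)) := by
  refine ((ext_continuous hF).comp_aestronglyMeasurable hρ).congr (ae_of_all _ fun x => ?_)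
  simp [max_eq_left (h0 x)]

lemma q43_rho {Ψ Ψ' : ℝ → ℝ} {n n' M : ℝ} (hΨ : IsPsi Ψ Ψ' n n') {ρ : R3 → ℝ}
    (hρ : MemRM Ψ M ρ) : Integrable (fun x => q43 (ρ x)) := by
  obtain ⟨A, hA⟩ := psi_q43 hΨ
  refine ((hρ.integrable.add hρ.psi_int).const_mul A).mono'
    (q43_continuous.comp_aestronglyMeasurable hρ.integrable.aestronglyMeasurable)
    (ae_of_all _ fun x => ?_)
  rw [Real.norm_eq_abs, abs_of_nonneg (q43_nonneg _)]
  exact hA _ (hρ.nonneg x)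

lemma variation {Ψ Ψ' : ℝ → ℝ} {n n' M : ℝ} (hΨ : IsPsi Ψ Ψ' n n') {ρ₀ σ : R3 → ℝ}
    (hρ₀ : MemRM Ψ M ρ₀) (hmin : ∀ ρ, MemRM Ψ M ρ → Hr Ψ ρ₀ ≤ Hr Ψ ρ)
    (hσ : Integrable σ) (hσ' : Integrable (fun x => q43 (σ x))) (hσ0 : ∫ x, σ x = 0)
    {c k : ℝ} (hc : ∀ x, |σ x| ≤ c) (hk : ∀ x, σ x ≠ 0 → ρ₀ x ≤ k)
    (hneg : ∀ x, 0 ≤ ρ₀ x + σ x) :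
    Integrable (fun x => σ x * (Ψ' (ρ₀ x) + U0rho ρ₀ x)) ∧
      0 ≤ ∫ x, σ x * (Ψ' (ρ₀ x) + U0rho ρ₀ x) := by
  have hρq := q43_rho hΨ hρ₀
  have iU := sigmaU_integrable hρ₀.integrable hσ hρq hσ'
  have hΨc : ContinuousOn Ψ (Ici 0) := fun s hs => (hΨ.hasDeriv s hs).continuousAt.continuousWithinAt
  -- nonnegativity and bounds of the perturbed density
  have nn : ∀ ε : ℝ, 0 ≤ ε → ε ≤ 1 → ∀ x, 0 ≤ ρ₀ x + ε * σ x := by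
    intro ε h0 h1 x
    have := hneg x
    have := hρ₀.nonneg x
    nlinarith
  have ub : ∀ ε : ℝ, 0 ≤ ε → ε ≤ 1 → ∀ x, σ x ≠ 0 → ρ₀ x + ε * σ x ≤ k + c := by
    intro ε h0 h1 x hx
    have h2 := hk x hx
    have h3 := (le_abs_self (σ x)).trans (hc x)
    have h4 : 0 ≤ c := (abs_nonneg _).trans (hc x)
    nlinarith
  have aem : ∀ ε : ℝ, AEStronglyMeasurable (fun x => ρ₀ x + ε * σ x) := fun ε =>
    (hρ₀.integrable.add (hσ.const_mul ε)).aestronglyMeasurable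
  set L := Ψ' (k + c) with hL
  have bd : ∀ ε : ℝ, 0 ≤ ε → ε ≤ 1 → ∀ x, ‖σ x * Ψ' (ρ₀ x + ε * σ x)‖ ≤ L * |σ x| := by
    intro ε h0 h1 x
    by_cases hx : σ x = 0
    · simp [hx]
    rw [norm_mul, Real.norm_eq_abs, Real.norm_eq_abs, abs_of_nonneg (psi_nonneg hΨ (nn ε h0 h1 x)),
      mul_comm]
    exact mul_le_mul_of_nonneg_right (psi_mono hΨ (nn ε h0 h1 x) (ub ε h0 h1 x hx)) (abs_nonneg _)
  have ms : ∀ ε : ℝ, 0 ≤ ε → ε ≤ 1 →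
      AEStronglyMeasurable (fun x => σ x * Ψ' (ρ₀ x + ε * σ x)) := fun ε h0 h1 =>
    hσ.aestronglyMeasurable.mul (comp_aesm hΨ.derivCont (aem ε) (nn ε h0 h1))
  have iL : Integrable (fun x => L * |σ x|) := hσ.abs.const_mul L
  have iΨ' : ∀ ε : ℝ, 0 ≤ ε → ε ≤ 1 → Integrable (fun x => σ x * Ψ' (ρ₀ x + ε * σ x)) :=
    fun ε h0 h1 => iL.mono' (ms ε h0 h1) (ae_of_all _ (bd ε h0 h1))
  have i0 : Integrable (fun x => σ x * Ψ' (ρ₀ x)) := by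
    simpa using iΨ' 0 le_rfl zero_le_one
  have main : ∀ ε : ℝ, 0 < ε → ε ≤ 1 →
      0 ≤ (∫ x, σ x * Ψ' (ρ₀ x + ε * σ x)) + (∫ x, σ x * U0rho ρ₀ x) - ε / 2 * Dpair σ := by
    intro ε h0 h1
    have idiff : Integrable (fun x => Ψ (ρ₀ x + ε * σ x) - Ψ (ρ₀ x)) := by
      refine iL.mono' ((comp_aesm hΨc (aem ε) (nn ε h0.le h1)).sub
        hρ₀.psi_int.aestronglyMeasurable) (ae_of_all _ fun x => ?_)
      by_cases hx : σ x = 0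
      · simp [hx]
      have u0 := ub 0 le_rfl zero_le_one x hx
      rw [zero_mul, add_zero] at u0
      have hl := psi_lip hΨ (hρ₀.nonneg x) (nn ε h0.le h1 x) u0 (ub ε h0.le h1 x hx)
      have hL0 : 0 ≤ L := psi_nonneg hΨ ((hρ₀.nonneg x).trans u0)
      rw [Real.norm_eq_abs]
      refine hl.trans (mul_le_mul_of_nonneg_left ?_ hL0)
      rw [add_sub_cancel_left, abs_mul, abs_of_pos h0]
      exact mul_le_of_le_one_left (abs_nonneg _) h1
    have ip : Integrable (fun x => Ψ (ρ₀ x + ε * σ x)) := by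
      refine (idiff.add hρ₀.psi_int).congr (ae_of_all _ fun x => ?_)
      simp
    have hmem : MemRM Ψ M (fun x => ρ₀ x + ε * σ x) := by
      refine ⟨nn ε h0.le h1, hρ₀.integrable.add (hσ.const_mul ε), ?_, ip⟩
      rw [integral_add hρ₀.integrable (hσ.const_mul ε), integral_const_mul, hσ0, hρ₀.mass]
      simp
    have hH := hmin _ hmem
    unfold Hr Epot at hH
    rw [Dpair_expand hρ₀.integrable hσ hρq hσ' ε] at hH
    have hle : (∫ x, Ψ (ρ₀ x + ε * σ x)) - ∫ x, Ψ (ρ₀ x) ≤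
        ε * ∫ x, σ x * Ψ' (ρ₀ x + ε * σ x) := by
      rw [← integral_sub ip hρ₀.psi_int, ← integral_const_mul]
      refine integral_mono idiff ((iΨ' ε h0.le h1).const_mul ε) fun x => ?_
      have := psi_conv hΨ (hρ₀.nonneg x) (nn ε h0.le h1 x)
      simp only
      linarith
    have : 0 ≤ ε * ((∫ x, σ x * Ψ' (ρ₀ x + ε * σ x)) + (∫ x, σ x * U0rho ρ₀ x)
        - ε / 2 * Dpair σ) := by
      linarith
    exact nonneg_of_mul_nonneg_right this h0
  have iG : Integrable (fun x => σ x * (Ψ' (ρ₀ x) + U0rho ρ₀ x)) := by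
    simp only [mul_add]
    exact i0.add iU
  refine ⟨iG, ?_⟩
  have eG : ∫ x, σ x * (Ψ' (ρ₀ x) + U0rho ρ₀ x) =
      (∫ x, σ x * Ψ' (ρ₀ x)) + (∫ x, σ x * U0rho ρ₀ x) - 0 / 2 * Dpair σ := by
    simp only [mul_add]
    rw [integral_add i0 iU]
    simp
  rw [eG]
  have e0 : ∀ j : ℕ, (0:ℝ) < 1 / ((j:ℝ) + 1) := fun j => by positivity
  have e1 : ∀ j : ℕ, 1 / ((j:ℝ) + 1) ≤ (1:ℝ) := fun j => by
    rw [div_le_one (by positivity)]; linarith [(Nat.cast_nonneg j : (0:ℝ) ≤ j)]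
  have et : Tendsto (fun j : ℕ => 1 / ((j:ℝ) + 1)) atTop (𝓝 0) :=
    tendsto_one_div_add_atTop_nhds_zero_nat
  have lim1 : Tendsto (fun j : ℕ => ∫ x, σ x * Ψ' (ρ₀ x + 1 / ((j:ℝ) + 1) * σ x)) atTop
      (𝓝 (∫ x, σ x * Ψ' (ρ₀ x))) := by
    refine tendsto_integral_of_dominated_convergence (fun x => L * |σ x|)
      (fun j => ms _ (e0 j).le (e1 j)) iL (fun j => ae_of_all _ (bd _ (e0 j).le (e1 j)))
      (ae_of_all _ fun x => ?_)
    refine Tendsto.const_mul _ ?_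
    have hcont := ((ext_continuous hΨ.derivCont).tendsto (ρ₀ x + 0 * σ x)).comp
      ((et.mul_const (σ x)).const_add (ρ₀ x))
    have hl : max (ρ₀ x + 0 * σ x) 0 = ρ₀ x := by simp [hρ₀.nonneg x]
    rw [hl] at hcont
    refine hcont.congr fun j => ?_
    simp only [Function.comp]
    rw [max_eq_left (nn _ (e0 j).le (e1 j) x)]
  exact ge_of_tendsto' ((lim1.add_const _).sub ((et.div_const 2).mul_const _))
    (fun j => main _ (e0 j) (e1 j))

lemma exists_level {α : Type*} [MeasurableSpace α] {μ : Measure α} {G : α → ℝ} {P : Set α}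
    (h : ∀ q : ℝ, (∀ᵐ x ∂μ, x ∈ P → G x ≤ q) ∨ (∀ᵐ x ∂μ, q ≤ G x)) (hP : μ P ≠ 0) :
    ∃ E : ℝ, ∀ᵐ x ∂μ, E ≤ G x ∧ (x ∈ P → G x ≤ E) := by
  set S := {q : ℝ | ∀ᵐ x ∂μ, q ≤ G x} with hS
  have hP' : ¬ ∀ᵐ x ∂μ, x ∉ P := by
    intro hh
    apply hP
    simpa [ae_iff] using hh
  have hne : S.Nonempty := by
    by_contra hh
    rw [not_nonempty_iff_eq_empty] at hh
    have : ∀ j : ℕ, ∀ᵐ x ∂μ, x ∈ P → G x ≤ -(j:ℝ) := fun j => (h _).resolve_right fun h' => by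
      have : -(j:ℝ) ∈ S := h'
      simp [hh] at this
    apply hP'
    filter_upwards [ae_all_iff.2 this] with x hx hxP
    obtain ⟨j, hj⟩ := exists_nat_gt (-G x)
    linarith [hx j hxP]
  have hbd : BddAbove S := by
    by_contra hh
    rw [not_bddAbove_iff] at hh
    have : ∀ j : ℕ, ∀ᵐ x ∂μ, (j:ℝ) ≤ G x := fun j => by
      obtain ⟨q, hq, hjq⟩ := hh j
      filter_upwards [hq] with x hx
      linarith
    apply hP'
    filter_upwards [ae_all_iff.2 this] with x hx
    obtain ⟨j, hj⟩ := exists_nat_gt (G x)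
    linarith [hx j]
  refine ⟨sSup S, ?_⟩
  have h1 : ∀ j : ℕ, ∀ᵐ x ∂μ, sSup S - 1 / ((j:ℝ) + 1) ≤ G x := fun j => by
    have hj : (0:ℝ) < 1 / ((j:ℝ) + 1) := by positivity
    obtain ⟨q, hq, hlt⟩ := exists_lt_of_lt_csSup hne (sub_lt_self (sSup S) hj)
    filter_upwards [hq] with x hx
    linarith
  have h2 : ∀ j : ℕ, ∀ᵐ x ∂μ, x ∈ P → G x ≤ sSup S + 1 / ((j:ℝ) + 1) := fun j => by
    have hj : (0:ℝ) < 1 / ((j:ℝ) + 1) := by positivity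
    refine (h _).resolve_right fun h' => ?_
    have := le_csSup hbd (show sSup S + 1 / ((j:ℝ) + 1) ∈ S from h')
    linarith
  have et : Tendsto (fun j : ℕ => 1 / ((j:ℝ) + 1)) atTop (𝓝 0) :=
    tendsto_one_div_add_atTop_nhds_zero_nat
  filter_upwards [ae_all_iff.2 h1, ae_all_iff.2 h2] with x hx1 hx2
  constructor
  · have := le_of_tendsto' (et.const_sub (sSup S)) hx1
    simpa using this
  · intro hxP
    have := ge_of_tendsto' (et.const_add (sSup S)) (fun j => hx2 j hxP)
    simpa using this

lemma exists_subset {T : Set R3} (hT : NullMeasurableSet T) (hT0 : volume T ≠ 0) {w : R3 → ℝ}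
    (hw : AEMeasurable w) :
    ∃ A ⊆ T, MeasurableSet A ∧ volume A ≠ 0 ∧ volume A ≠ ⊤ ∧ ∃ k : ℝ, ∀ x ∈ A, w x ≤ k := by
  have hU : (⋃ k : ℕ, (T ∩ {x | w x ≤ k}) ∩ Metric.ball 0 k) = T := by
    ext x
    simp only [mem_iUnion, mem_inter_iff, mem_ofPred_eq, Metric.mem_ball, dist_zero_right]
    constructor
    · rintro ⟨k, h⟩; exact h.1.1
    · intro hx
      obtain ⟨k, hk⟩ := exists_nat_gt (max (w x) ‖x‖)
      exact ⟨k, ⟨hx, (le_max_left _ _).trans hk.le⟩, (le_max_right _ _).trans_lt hk⟩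
  have : ∃ k : ℕ, volume ((T ∩ {x | w x ≤ k}) ∩ Metric.ball 0 k) ≠ 0 := by
    by_contra hh
    push Not at hh
    apply hT0
    rw [← hU]
    exact measure_iUnion_null hh
  obtain ⟨k, hk⟩ := this
  have hm : NullMeasurableSet ((T ∩ {x | w x ≤ k}) ∩ Metric.ball 0 k) :=
    (hT.inter (nullMeasurableSet_le hw aemeasurable_const)).inter
      measurableSet_ball.nullMeasurableSet
  obtain ⟨A, hA, hAm, hAe⟩ := hm.exists_measurable_subset_ae_eq
  refine ⟨A, fun x hx => (hA hx).1.1, hAm, ?_, ?_, k, fun x hx => (hA hx).1.2⟩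
  · rwa [measure_congr hAe]
  · exact ((measure_mono (hA.trans inter_subset_right)).trans_lt measure_ball_lt_top).ne

lemma U0_aesm {ρ : R3 → ℝ} (hρ : AEStronglyMeasurable ρ) : AEStronglyMeasurable (U0rho ρ) := by
  have m1 : AEStronglyMeasurable (fun p : R3 × R3 => ρ p.2 / ‖p.1 - p.2‖)
      (volume.prod volume) := by
    have m2 : Measurable (fun p : R3 × R3 => ‖p.1 - p.2‖⁻¹) := by fun_prop
    simp only [div_eq_mul_inv]
    exact hρ.comp_snd.mul m2.aestronglyMeasurable
  exact m1.integral_prod_right'.neg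

lemma dichotomy {Ψ Ψ' : ℝ → ℝ} {n n' M : ℝ} (hΨ : IsPsi Ψ Ψ' n n') {ρ₀ : R3 → ℝ}
    (hρ₀ : MemRM Ψ M ρ₀) (hmin : ∀ ρ, MemRM Ψ M ρ → Hr Ψ ρ₀ ≤ Hr Ψ ρ) (q : ℝ) :
    (∀ᵐ x ∂(volume : Measure R3), x ∈ {x | 0 < ρ₀ x} → Ψ' (ρ₀ x) + U0rho ρ₀ x ≤ q) ∨
    (∀ᵐ x ∂(volume : Measure R3), q ≤ Ψ' (ρ₀ x) + U0rho ρ₀ x) := by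
  have mρ := hρ₀.integrable.aestronglyMeasurable
  have mG : AEMeasurable (fun x => Ψ' (ρ₀ x) + U0rho ρ₀ x) :=
    ((comp_aesm hΨ.derivCont mρ hρ₀.nonneg).add (U0_aesm mρ)).aemeasurable
  set G := fun x => Ψ' (ρ₀ x) + U0rho ρ₀ x with hG
  by_contra hcon
  push Not at hcon
  obtain ⟨hc1, hc2⟩ := hcon
  have hB0 : volume ({x | 0 < ρ₀ x} ∩ {x | q < G x}) ≠ 0 := by
    intro h0
    apply hc1
    rw [ae_iff]
    convert h0 using 2
    ext x
    simp [hG]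
  have hA0 : volume {x | G x < q} ≠ 0 := by
    intro h0
    apply hc2
    rw [ae_iff]
    simpa using h0
  obtain ⟨A, hA, hAm, hA1, hA2, k, hAk⟩ := exists_subset
    (nullMeasurableSet_lt mG aemeasurable_const) hA0 mρ.aemeasurable
  obtain ⟨B, hB, hBm, hB1, hB2, l, hBl⟩ := exists_subset
    ((nullMeasurableSet_lt aemeasurable_const mρ.aemeasurable).inter
      (nullMeasurableSet_lt aemeasurable_const mG)) hB0
    (mρ.aemeasurable.add mρ.aemeasurable.inv)
  set a := volume.real A with ha
  set b := volume.real B with hb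
  have ha0 : 0 < a := ENNReal.toReal_pos hA1 hA2
  have hb0 : 0 < b := ENNReal.toReal_pos hB1 hB2
  have hl0 : 0 < max l 1 := lt_of_lt_of_le one_pos (le_max_right _ _)
  set δ := 1 / (max l 1 * a) with hδ
  have hδ0 : 0 < δ := by positivity
  have hdis : Disjoint A B := by
    rw [Set.disjoint_left]
    intro x hx hx'
    have h1 : G x < q := hA hx
    have h2 : q < G x := (hB hx').2
    linarith
  set σ : R3 → ℝ := fun x => A.indicator (fun _ => δ * b) x - B.indicator (fun _ => δ * a) x
    with hσdef
  have sA : ∀ x ∈ A, σ x = δ * b := fun x hx => by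
    simp [hσdef, hx, Set.disjoint_left.1 hdis hx]
  have sB : ∀ x ∈ B, σ x = -(δ * a) := fun x hx => by
    simp [hσdef, hx, Set.disjoint_right.1 hdis hx]
  have s0 : ∀ x, x ∉ A → x ∉ B → σ x = 0 := fun x hx hx' => by
    simp [hσdef, hx, hx']
  have iA : Integrable (A.indicator (fun _ : R3 => δ * b)) :=
    (integrable_indicator_iff hAm).2 (integrableOn_const hA2)
  have iB : Integrable (B.indicator (fun _ : R3 => δ * a)) :=
    (integrable_indicator_iff hBm).2 (integrableOn_const hB2)
  have hσ : Integrable σ := iA.sub iB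
  have hq0 : q43 0 = 0 := by simp [q43]
  have hσ' : Integrable (fun x => q43 (σ x)) := by
    have : Integrable (fun x => A.indicator (fun _ : R3 => q43 (δ * b)) x
        + B.indicator (fun _ : R3 => q43 (-(δ * a))) x) :=
      ((integrable_indicator_iff hAm).2 (integrableOn_const hA2)).add
        ((integrable_indicator_iff hBm).2 (integrableOn_const hB2))
    refine this.congr (ae_of_all _ fun x => ?_)
    by_cases hx : x ∈ A
    · simp [sA x hx, hx, Set.disjoint_left.1 hdis hx]
    by_cases hx' : x ∈ B
    · simp [sB x hx', hx, hx']
    · simp [s0 x hx hx', hx, hx', hq0]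
  have hσ0 : ∫ x, σ x = 0 := by
    rw [hσdef, integral_sub iA iB, integral_indicator_const _ hAm, integral_indicator_const _ hBm]
    simp only [smul_eq_mul]
    ring
  have hc : ∀ x, |σ x| ≤ δ * b + δ * a := by
    intro x
    have h1 : 0 < δ * b := by positivity
    have h2 : 0 < δ * a := by positivity
    by_cases hx : x ∈ A
    · rw [sA x hx, abs_of_pos h1]; linarith
    by_cases hx' : x ∈ B
    · rw [sB x hx', abs_neg, abs_of_pos h2]; linarith
    · rw [s0 x hx hx', abs_zero]; linarith
  have hBl1 : ∀ x ∈ B, ρ₀ x ≤ l := fun x hx => by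
    have h1 : ρ₀ x + (ρ₀ x)⁻¹ ≤ l := hBl x hx
    have := inv_nonneg.2 (hρ₀.nonneg x)
    linarith
  have hk : ∀ x, σ x ≠ 0 → ρ₀ x ≤ max k l := by
    intro x hx
    by_cases hxA : x ∈ A
    · exact (hAk x hxA).trans (le_max_left _ _)
    by_cases hxB : x ∈ B
    · exact (hBl1 x hxB).trans (le_max_right _ _)
    · exact absurd (s0 x hxA hxB) hx
  have hneg : ∀ x, 0 ≤ ρ₀ x + σ x := by
    intro x
    have hr := hρ₀.nonneg x
    by_cases hx : x ∈ A
    · rw [sA x hx]; positivity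
    by_cases hx' : x ∈ B
    · rw [sB x hx']
      have hpos : 0 < ρ₀ x := (hB hx').1
      have h1 : ρ₀ x + (ρ₀ x)⁻¹ ≤ l := hBl x hx'
      have h2 : (ρ₀ x)⁻¹ ≤ max l 1 := by linarith [le_max_left l 1]
      have h3 : δ * a = (max l 1)⁻¹ := by
        rw [hδ]; field_simp
      have h4 : (max l 1)⁻¹ ≤ ρ₀ x := inv_le_of_inv_le₀ hpos h2
      linarith
    · rw [s0 x hx hx']; linarith
  obtain ⟨iG, hpos⟩ := variation hΨ hρ₀ hmin hσ hσ' hσ0 hc hk hneg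
  have iG' : Integrable (fun x => σ x * (q - G x)) := by
    refine ((hσ.mul_const q).sub iG).congr (ae_of_all _ fun x => ?_)
    simp only [Pi.sub_apply, hG]
    ring
  have eG' : ∫ x, σ x * (q - G x) ≤ 0 := by
    have : (fun x => σ x * (q - G x)) =
        fun x => σ x * q - σ x * (Ψ' (ρ₀ x) + U0rho ρ₀ x) := by
      ext x; simp only [hG]; ring
    rw [this, integral_sub (hσ.mul_const q) iG, integral_mul_const, hσ0]
    linarith
  have hnn : ∀ x, 0 ≤ σ x * (q - G x) := by
    intro x
    by_cases hx : x ∈ A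
    · have h1 : G x < q := hA hx
      rw [sA x hx]
      exact mul_nonneg (by positivity) (by linarith)
    by_cases hx' : x ∈ B
    · have h2 : q < G x := (hB hx').2
      rw [sB x hx']
      have : 0 < δ * a := by positivity
      nlinarith
    · rw [s0 x hx hx']; simp
  have hz : ∫ x, σ x * (q - G x) = 0 := le_antisymm eG' (integral_nonneg hnn)
  have hae := (integral_eq_zero_iff_of_nonneg hnn iG').1 hz
  apply hA1
  refine measure_mono_null (fun x hx => ?_) (ae_iff.1 hae)
  have h1 : G x < q := hA hx
  have : 0 < σ x * (q - G x) := by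
    rw [sA x hx]
    exact mul_pos (by positivity) (by linarith)
  exact this.ne'

/-- Euler-Lagrange identity for a minimizer of the reduced
functional: `ρ₀ = (Ψ')⁻¹(E₀ - U₀)` where `U₀ < E₀`, `ρ₀ = 0` where `U₀ ≥ E₀`. -/
theorem eulerLagrange_reduced
    (Ψ Ψ' : ℝ → ℝ) (n n' : ℝ) (hΨ : IsPsi Ψ Ψ' n n') (M : ℝ) (hM : 0 < M)
    (ρ₀ : R3 → ℝ) (hρ₀ : MemRM Ψ M ρ₀)
    (hmin : ∀ ρ, MemRM Ψ M ρ → Hr Ψ ρ₀ ≤ Hr Ψ ρ) :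
    ∃ E₀ : ℝ, ∀ᵐ x ∂(volume : Measure R3),
      (U0rho ρ₀ x < E₀ → 0 < ρ₀ x ∧ Ψ' (ρ₀ x) = E₀ - U0rho ρ₀ x) ∧
      (E₀ ≤ U0rho ρ₀ x → ρ₀ x = 0) := by
  have hP : volume {x | 0 < ρ₀ x} ≠ 0 := by
    intro h0
    have h1 : ρ₀ =ᵐ[volume] 0 := by
      have : ∀ᵐ x ∂(volume : Measure R3), ¬ 0 < ρ₀ x := by
        rw [ae_iff]; simpa using h0
      filter_upwards [this] with x hx
      exact le_antisymm (not_lt.1 hx) (hρ₀.nonneg x)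
    have h2 := hρ₀.mass
    rw [integral_congr_ae h1] at h2
    simp at h2
    linarith
  obtain ⟨E, hE⟩ := exists_level (dichotomy hΨ hρ₀ hmin) hP
  refine ⟨E, ?_⟩
  filter_upwards [hE] with x hx
  obtain ⟨hx1, hx2⟩ := hx
  have hr := hρ₀.nonneg x
  constructor
  · intro hU
    have hpos : 0 < ρ₀ x := by
      rcases hr.eq_or_lt with h | h
      · rw [← h, hΨ.deriv_zero] at hx1
        linarith
      · exact h
    have := hx2 hpos
    exact ⟨hpos, by linarith⟩
  · intro hU
    by_contra h
    have hpos : 0 < ρ₀ x := lt_of_le_of_ne hr (Ne.symm h)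
    have h1 := hx2 hpos
    have h2 := psi_pos hΨ hpos
    linarith
end
end

section
/- Let Φ : [0,∞) → [0,∞) be C¹ with Φ(0) = Φ'(0) = 0, strictly convex, and suppose there exist constants C₁, C₂ > 0, thresholds F₁, F₂ > 0 and exponents 0 < k < 3/2, 0 < k' < 3/2 such that Φ(f) ≥ C₁ f^{1+1/k} for f ≥ F₁ and Φ(f) ≤ C₂ f^{1+1/k'} for 0 ≤ f ≤ F₂. Define Ψ(s) := inf{ ∫ ((1/2)|v|² g(v) + Φ(g(v))) dv : g ∈ L¹₊(ℝ³), ∫ g = s }. Then Ψ is strictly convex on [0,∞), and with n := k + 3/2 and n' := k' + 3/2 (so 0 < n, n' < 3) there exist constants c₁, c₂ > 0 and thresholds s₁, s₂ > 0 with Ψ(ρ) ≥ c₁ ρ^{1+1/n} for ρ ≥ s₁ and Ψ(ρ) ≤ c₂ ρ^{1+1/n'} for 0 ≤ ρ ≤ s₂. -/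
open MeasureTheory Filter Topology Set ENNReal

noncomputable section

theorem aux_tangent {Φ Φ' : ℝ → ℝ} {k k' : ℝ} (hΦ : IsPhi Φ Φ' k k') {x y : ℝ}
    (hx : 0 ≤ x) (hy : 0 ≤ y) : Φ x + Φ' x * (y - x) ≤ Φ y := by
  rcases lt_trichotomy x y with h | h | h
  · have := hΦ.sconvex.lt_slope_of_hasDerivAt hx hy h (hΦ.hasDeriv x hx)
    rw [slope_def_field, lt_div_iff₀ (by linarith)] at this
    linarith
  · subst h; simp
  · have := hΦ.sconvex.slope_lt_of_hasDerivAt hy hx h (hΦ.hasDeriv x hx)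
    rw [slope_def_field, div_lt_iff₀ (by linarith)] at this
    linarith

theorem aux_strictMono {Φ Φ' : ℝ → ℝ} {k k' : ℝ} (hΦ : IsPhi Φ Φ' k k') :
    StrictMonoOn Φ' (Ici 0) := by
  intro x hx y hy h
  have h1 := hΦ.sconvex.lt_slope_of_hasDerivAt hx hy h (hΦ.hasDeriv x hx)
  have h2 := hΦ.sconvex.slope_lt_of_hasDerivAt hx hy h (hΦ.hasDeriv y hy)
  linarith

theorem aux_contMax {Φ Φ' : ℝ → ℝ} {k k' : ℝ} (hΦ : IsPhi Φ Φ' k k') :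
    Continuous (fun x => Φ (max 0 x)) := by
  have h : ContinuousOn Φ (Ici 0) := fun x hx =>
    (hΦ.hasDeriv x hx).continuousAt.continuousWithinAt
  exact h.comp_continuous (by fun_prop) (fun x => le_max_left 0 x)

theorem aux_unbounded {Φ Φ' : ℝ → ℝ} {k k' : ℝ} (hΦ : IsPhi Φ Φ' k k') (y : ℝ) :
    ∃ x, 0 ≤ x ∧ y ≤ Φ' x := by
  obtain ⟨C, hC, F, hF, h⟩ := hΦ.growth_large
  have hk := hΦ.k_pos
  have ht : Tendsto (fun x : ℝ => C * x ^ (1 / k)) atTop atTop :=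
    (tendsto_rpow_atTop (by positivity)).const_mul_atTop hC
  obtain ⟨x, hx1, hx2⟩ := ((ht.eventually_ge_atTop y).and (eventually_ge_atTop F)).exists
  have hx0 : 0 < x := by linarith
  refine ⟨x, hx0.le, hx1.trans ?_⟩
  have h1 := aux_tangent hΦ hx0.le le_rfl
  have h2 := h x hx2
  rw [Real.rpow_add hx0, Real.rpow_one] at h2
  rw [hΦ.zero] at h1
  have : x * (C * x ^ (1 / k)) ≤ x * Φ' x := by nlinarith
  exact le_of_mul_le_mul_left this hx0

theorem aux_inverse {Φ Φ' : ℝ → ℝ} {k k' : ℝ} (hΦ : IsPhi Φ Φ' k k') :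
    ∃ G : ℝ → ℝ, Continuous G ∧ Monotone G ∧ (∀ y, 0 ≤ G y) ∧ (∀ y, y ≤ 0 → G y = 0) ∧
      (∀ y, 0 ≤ y → Φ' (G y) = y) ∧ (∀ x, 0 ≤ x → G (Φ' x) = x) := by
  have hsm := aux_strictMono hΦ
  have hpos : ∀ x, 0 ≤ x → 0 ≤ Φ' x := by
    intro x hx
    have := hsm.monotoneOn (self_mem_Ici) (show x ∈ Ici (0:ℝ) from hx) hx
    rwa [hΦ.deriv_zero] at this
  let F : ℝ → ℝ := fun x => Φ' (max 0 x) + min 0 x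
  have hFc : Continuous F :=
    (hΦ.derivCont.comp_continuous (by fun_prop) (fun x => le_max_left 0 x)).add (by fun_prop)
  have hFp : ∀ x, 0 ≤ x → F x = Φ' x := by intro x hx; simp [F, hx]
  have hFn : ∀ x, x ≤ 0 → F x = x := by intro x hx; simp [F, hx, hΦ.deriv_zero]
  have hF : StrictMono F := by
    intro x y h
    rcases le_total 0 x with hx | hx
    · rw [hFp x hx, hFp y (by linarith)]
      exact hsm hx (show (0:ℝ) ≤ y by linarith) h
    · rcases le_total 0 y with hy | hy
      · rcases hx.eq_or_lt with h0 | h0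
        · subst h0
          rw [hFp 0 le_rfl, hFp y hy]
          exact hsm self_mem_Ici hy h
        · rw [hFn x hx, hFp y hy]
          linarith [hpos y hy]
      · rw [hFn x hx, hFn y hy]; exact h
  have hs : Function.Surjective F := by
    intro y
    obtain ⟨x, hx, hxy⟩ := aux_unbounded hΦ y
    have h1 : F (min 0 y) ≤ y := by rw [hFn _ (min_le_left _ _)]; exact min_le_right _ _
    have h2 : y ≤ F x := by rw [hFp x hx]; exact hxy
    exact mem_range_of_exists_le_of_exists_ge hFc ⟨_, h1⟩ ⟨_, h2⟩
  let e := hF.orderIsoOfSurjective F hs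
  have he : ∀ x, e x = F x := fun x => rfl
  have hes : ∀ y, F (e.symm y) = y := fun y => e.apply_symm_apply y
  have hes' : ∀ x, e.symm (F x) = x := fun y => e.symm_apply_apply y
  have hF0 : F 0 = 0 := hFn 0 le_rfl
  have he0 : e.symm 0 = 0 := by rw [← hF0]; simpa [hF0] using hes' 0
  refine ⟨fun y => max 0 (e.symm y), ?_, ?_, ?_, ?_, ?_, ?_⟩
  · exact continuous_const.max e.symm.continuous
  · exact monotone_const.max e.symm.monotone
  · intro y; exact le_max_left _ _
  · intro y hy
    apply max_eq_left
    rw [← he0]; exact e.symm.monotone hy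
  · intro y hy
    have h0 : 0 ≤ e.symm y := by rw [← he0]; exact e.symm.monotone hy
    simp only [max_eq_right h0]
    rw [← hFp _ h0, hes]
  · intro x hx
    simp only
    rw [← hFp x hx, hes', max_eq_right hx]

/-- feasibility of a velocity profile -/
def Feas (Φ : ℝ → ℝ) (s : ℝ) (g : R3 → ℝ) : Prop :=
  (∀ v, 0 ≤ g v) ∧ Integrable g ∧ (∫ v, g v) = s ∧
    Integrable (fun v => (1/2) * ‖v‖ ^ 2 * g v + Φ (g v))

/-- energy of a velocity profile -/
def En (Φ : ℝ → ℝ) (g : R3 → ℝ) : ℝ := ∫ v, ((1/2) * ‖v‖ ^ 2 * g v + Φ (g v))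

theorem aux_int_G {H : ℝ → ℝ} {G : ℝ → ℝ} (hG : Continuous G) (hG0 : ∀ y, y ≤ 0 → G y = 0)
    (hGn : ∀ y, 0 ≤ G y)
    (hH : Continuous (fun x => H (max 0 x))) (hH0 : H 0 = 0) (l : ℝ) :
    Integrable (fun v : R3 => G (l - (1/2) * ‖v‖ ^ 2)) ∧
    Integrable (fun v : R3 => (1/2) * ‖v‖ ^ 2 * G (l - (1/2) * ‖v‖ ^ 2) +
      H (G (l - (1/2) * ‖v‖ ^ 2))) := by
  have hz : ∀ v : R3, v ∉ Metric.closedBall (0:R3) (2 * |l| + 1) →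
      G (l - (1/2) * ‖v‖ ^ 2) = 0 := by
    intro v hv
    simp only [Metric.mem_closedBall, dist_zero_right, not_le] at hv
    apply hG0
    have := le_abs_self l
    have := abs_nonneg l
    nlinarith
  have hc1 : Continuous (fun v : R3 => G (l - (1/2) * ‖v‖ ^ 2)) := by fun_prop
  have hc2 : Continuous (fun v : R3 => (1/2) * ‖v‖ ^ 2 * G (l - (1/2) * ‖v‖ ^ 2) +
      H (G (l - (1/2) * ‖v‖ ^ 2))) := by
    refine Continuous.add (by fun_prop) ?_
    have := hH.comp hc1
    refine this.congr ?_
    intro v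
    simp [hGn]
  constructor
  · exact hc1.integrable_of_hasCompactSupport
      (HasCompactSupport.intro (isCompact_closedBall _ _) hz)
  · refine hc2.integrable_of_hasCompactSupport
      (HasCompactSupport.intro (isCompact_closedBall (0:R3) (2 * |l| + 1)) ?_)
    intro v hv
    simp only [hz v hv, hH0]; simp

theorem aux_ball_pos : 0 < volume.real (Metric.closedBall (0:R3) 1) := by
  apply ENNReal.toReal_pos
  · exact (Metric.measure_closedBall_pos _ _ one_pos).ne'
  · exact measure_closedBall_lt_top.ne

theorem aux_ball (R : ℝ) (hR : 0 ≤ R) : volume.real (Metric.closedBall (0:R3) R) =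
    R ^ 3 * volume.real (Metric.closedBall (0:R3) 1) := by
  rw [Measure.addHaar_real_closedBall' _ _ hR]
  simp

theorem aux_int_ball (R M : ℝ) :
    Integrable ((Metric.closedBall (0:R3) R).indicator (fun _ => M)) :=
  (integrable_const_on R M)
where
  integrable_const_on (R M : ℝ) :
      Integrable ((Metric.closedBall (0:R3) R).indicator (fun _ => M)) := by
    rw [integrable_indicator_iff Metric.isClosed_closedBall.measurableSet]
    exact integrableOn_const measure_closedBall_lt_top.ne

theorem aux_integral_ball (R M : ℝ) (hR : 0 ≤ R) :
    ∫ v, (Metric.closedBall (0:R3) R).indicator (fun _ => M) v =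
      M * (R ^ 3 * volume.real (Metric.closedBall (0:R3) 1)) := by
  rw [integral_indicator_const _ Metric.isClosed_closedBall.measurableSet, aux_ball R hR,
    smul_eq_mul, mul_comm]

theorem aux_exists_min {Φ Φ' : ℝ → ℝ} {k k' : ℝ} (hΦ : IsPhi Φ Φ' k k') {s : ℝ} (hs : 0 ≤ s) :
    ∃ g, Feas Φ s g ∧ ∀ g', Feas Φ s g' → En Φ g ≤ En Φ g' := by
  obtain ⟨G, hGc, hGm, hGn, hG0, hG1, hG2⟩ := aux_inverse hΦ
  have hint := aux_int_G hGc hG0 hGn (aux_contMax hΦ) hΦ.zero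
  set c := volume.real (Metric.closedBall (0:R3) 1) with hc
  have hcpos : 0 < c := aux_ball_pos
  obtain ⟨L, hL0, hL⟩ : ∃ L, 0 ≤ L ∧ s ≤ ∫ v : R3, G (L - (1/2) * ‖v‖ ^ 2) := by
    have h0 : 0 ≤ s / c := by positivity
    have hp : 0 ≤ Φ' (s / c) := by
      have := (aux_strictMono hΦ).monotoneOn (self_mem_Ici) (show s / c ∈ Ici (0:ℝ) from h0) h0
      rwa [hΦ.deriv_zero] at this
    refine ⟨Φ' (s / c) + 1/2, by linarith, ?_⟩
    have h1 := aux_integral_ball 1 (s / c) zero_le_one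
    have h2 : s / c * (1 ^ 3 * c) = s := by field_simp
    rw [← hc, h2] at h1
    refine h1.symm.le.trans ?_
    refine integral_mono (aux_int_ball _ _) (hint _).1 ?_
    intro v
    by_cases hv : v ∈ Metric.closedBall (0:R3) 1
    · rw [indicator_of_mem hv]
      have h3 : ‖v‖ ≤ 1 := by simpa using hv
      calc s / c = G (Φ' (s / c)) := (hG2 _ h0).symm
        _ ≤ _ := hGm (by nlinarith [norm_nonneg v])
    · rw [indicator_of_notMem hv]; exact hGn _
  have hcont : Continuous (fun l : ℝ => ∫ v : R3, G (min l L - (1/2) * ‖v‖ ^ 2)) := by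
    refine continuous_of_dominated (bound := fun v => G (L - (1/2) * ‖v‖ ^ 2))
      (fun l => (hint _).1.aestronglyMeasurable) ?_ (hint L).1 ?_
    · intro l
      refine Eventually.of_forall fun v => ?_
      rw [Real.norm_of_nonneg (hGn _)]
      exact hGm (by linarith [min_le_right l L])
    · exact Eventually.of_forall fun v => by fun_prop
  have hz : ∫ v : R3, G (min 0 L - (1/2) * ‖v‖ ^ 2) = 0 := by
    rw [min_eq_left hL0]
    have : ∀ v : R3, G (0 - (1/2) * ‖v‖ ^ 2) = 0 := fun v => hG0 _ (by nlinarith [sq_nonneg ‖v‖])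
    simp only [this, integral_zero]
  obtain ⟨l', -, hl'⟩ := intermediate_value_Icc hL0 hcont.continuousOn
    (show s ∈ Icc _ _ by
      refine ⟨?_, ?_⟩
      · simp only [hz]; exact hs
      · simpa using hL)
  beta_reduce at hl'
  set l := min l' L
  refine ⟨fun v => G (l - (1/2) * ‖v‖ ^ 2), ⟨fun v => hGn _, (hint l).1, hl', (hint l).2⟩, ?_⟩
  rintro g ⟨hg0, hgi, hgs, hgE⟩
  have key : ∀ v : R3, ((1/2) * ‖v‖ ^ 2 * G (l - (1/2) * ‖v‖ ^ 2) +
      Φ (G (l - (1/2) * ‖v‖ ^ 2))) + l * (g v - G (l - (1/2) * ‖v‖ ^ 2)) ≤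
      (1/2) * ‖v‖ ^ 2 * g v + Φ (g v) := by
    intro v
    have ht := aux_tangent hΦ (hGn (l - (1/2) * ‖v‖ ^ 2)) (hg0 v)
    rcases le_total 0 (l - (1/2) * ‖v‖ ^ 2) with h | h
    · rw [hG1 _ h] at ht
      linarith
    · rw [hG0 _ h] at ht ⊢
      rw [hΦ.deriv_zero] at ht
      nlinarith [hg0 v]
  have hd : Integrable (fun v : R3 => l * (g v - G (l - (1/2) * ‖v‖ ^ 2))) :=
    (hgi.sub (hint l).1).const_mul l
  have := integral_mono ((hint l).2.add hd) hgE key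
  simp only [Pi.add_apply] at this
  rw [integral_add (hint l).2 hd, integral_const_mul, integral_sub hgi (hint l).1, hgs, hl'] at this
  unfold En
  linarith

theorem aux_nonneg {Φ Φ' : ℝ → ℝ} {k k' : ℝ} (hΦ : IsPhi Φ Φ' k k') {s : ℝ} {g : R3 → ℝ}
    (hg : Feas Φ s g) (v : R3) : 0 ≤ (1/2) * ‖v‖ ^ 2 * g v + Φ (g v) := by
  have h1 := hg.1 v
  have h2 := hΦ.nonneg _ h1
  positivity

theorem aux_psi_le {Φ Φ' : ℝ → ℝ} {k k' : ℝ} (hΦ : IsPhi Φ Φ' k k') {s : ℝ} {g : R3 → ℝ}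
    (hg : Feas Φ s g) : PsiOf Φ s ≤ En Φ g := by
  apply csInf_le
  · refine ⟨0, ?_⟩
    rintro r ⟨g, h1, h2, h3, h4, rfl⟩
    exact integral_nonneg fun v => aux_nonneg hΦ ⟨h1, h2, h3, h4⟩ v
  · exact ⟨g, hg.1, hg.2.1, hg.2.2.1, hg.2.2.2, rfl⟩

theorem aux_psi_eq {Φ Φ' : ℝ → ℝ} {k k' : ℝ} (hΦ : IsPhi Φ Φ' k k') {s : ℝ} (hs : 0 ≤ s) :
    ∃ g, Feas Φ s g ∧ PsiOf Φ s = En Φ g := by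
  obtain ⟨g, hg, hmin⟩ := aux_exists_min hΦ hs
  refine ⟨g, hg, le_antisymm (aux_psi_le hΦ hg) ?_⟩
  apply le_csInf
  · exact ⟨_, g, hg.1, hg.2.1, hg.2.2.1, hg.2.2.2, rfl⟩
  · rintro r ⟨g', h1, h2, h3, h4, rfl⟩
    exact hmin g' ⟨h1, h2, h3, h4⟩

theorem aux_strictConvex {Φ Φ' : ℝ → ℝ} {k k' : ℝ} (hΦ : IsPhi Φ Φ' k k') :
    StrictConvexOn ℝ (Ici 0) (PsiOf Φ) := by
  refine ⟨convex_Ici 0, ?_⟩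
  intro s hs t ht hst a b ha hb hab
  obtain ⟨g, hg, hgE⟩ := aux_psi_eq hΦ hs
  obtain ⟨h, hh, hhE⟩ := aux_psi_eq hΦ ht
  simp only [smul_eq_mul]
  have hu0 : ∀ v, 0 ≤ a * g v + b * h v := fun v => by
    have := hg.1 v; have := hh.1 v; positivity
  have hui : Integrable (fun v => a * g v + b * h v) :=
    (hg.2.1.const_mul a).add (hh.2.1.const_mul b)
  have hum : ∫ v, (a * g v + b * h v) = a * s + b * t := by
    rw [integral_add (hg.2.1.const_mul a) (hh.2.1.const_mul b), integral_const_mul,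
      integral_const_mul, hg.2.2.1, hh.2.2.1]
  have hlt : ∀ v, g v ≠ h v → (1/2) * ‖v‖ ^ 2 * (a * g v + b * h v) + Φ (a * g v + b * h v) <
      a * ((1/2) * ‖v‖ ^ 2 * g v + Φ (g v)) + b * ((1/2) * ‖v‖ ^ 2 * h v + Φ (h v)) := by
    intro v hv
    have := hΦ.sconvex.2 (hg.1 v) (hh.1 v) hv ha hb hab
    simp only [smul_eq_mul] at this
    linarith
  have hle : ∀ v, (1/2) * ‖v‖ ^ 2 * (a * g v + b * h v) + Φ (a * g v + b * h v) ≤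
      a * ((1/2) * ‖v‖ ^ 2 * g v + Φ (g v)) + b * ((1/2) * ‖v‖ ^ 2 * h v + Φ (h v)) := by
    intro v
    have := hΦ.sconvex.convexOn.2 (hg.1 v) (hh.1 v) ha.le hb.le hab
    simp only [smul_eq_mul] at this
    linarith
  have hRi : Integrable (fun v => a * ((1/2) * ‖v‖ ^ 2 * g v + Φ (g v)) +
      b * ((1/2) * ‖v‖ ^ 2 * h v + Φ (h v))) :=
    (hg.2.2.2.const_mul a).add (hh.2.2.2.const_mul b)
  have huE : Integrable (fun v => (1/2) * ‖v‖ ^ 2 * (a * g v + b * h v) +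
      Φ (a * g v + b * h v)) := by
    refine hRi.mono' ?_ (Eventually.of_forall fun v => ?_)
    · refine AEStronglyMeasurable.add ?_ ?_
      · exact (by fun_prop : Continuous fun v : R3 => (1/2) * ‖v‖ ^ 2).aestronglyMeasurable.mul
          hui.aestronglyMeasurable
      · refine ((aux_contMax hΦ).comp_aestronglyMeasurable hui.aestronglyMeasurable).congr
          (Eventually.of_forall fun v => ?_)
        simp only [Function.comp_apply, max_eq_right (hu0 v)]
    · rw [Real.norm_of_nonneg]
      · exact hle v
      · have h1 := hu0 v
        have h2 := hΦ.nonneg _ h1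
        positivity
  have hu : Feas Φ (a * s + b * t) (fun v => a * g v + b * h v) := ⟨hu0, hui, hum, huE⟩
  refine (aux_psi_le hΦ hu).trans_lt ?_
  rw [hgE, hhE]
  have hR : a * En Φ g + b * En Φ h = ∫ v, (a * ((1/2) * ‖v‖ ^ 2 * g v + Φ (g v)) +
      b * ((1/2) * ‖v‖ ^ 2 * h v + Φ (h v))) := by
    rw [integral_add (hg.2.2.2.const_mul a) (hh.2.2.2.const_mul b), integral_const_mul,
      integral_const_mul]; rfl
  rw [hR]
  refine lt_of_le_of_ne (integral_mono huE hRi hle) ?_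
  intro heq
  have hae := (integral_eq_iff_of_ae_le huE hRi (Eventually.of_forall hle)).1 heq
  apply hst
  rw [← hg.2.2.1, ← hh.2.2.1]
  apply integral_congr_ae
  filter_upwards [hae] with v hv
  by_contra hne
  exact (hlt v hne).ne hv

theorem aux_lower {Φ Φ' : ℝ → ℝ} {k k' : ℝ} (hΦ : IsPhi Φ Φ' k k') :
    ∃ c₁ > 0, ∃ s₁ > 0, ∀ s, s₁ ≤ s → c₁ * s ^ (1 + 1/(k + 3/2)) ≤ PsiOf Φ s := by
  obtain ⟨C, hC, F, hF, hgr⟩ := hΦ.growth_large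
  have hk := hΦ.k_pos
  set c := volume.real (Metric.closedBall (0:R3) 1) with hc
  have hcpos : 0 < c := aux_ball_pos
  set n := k + 3/2 with hn
  have hnpos : 0 < n := by positivity
  set K := 2 + 1 / C with hK
  have hKpos : 0 < K := by positivity
  refine ⟨(1 / (2 * K)) * (1 / (2 * c)) ^ (1/n), by positivity, 2 * c * F ^ (n / k),
    by positivity, ?_⟩
  intro s hs
  have hs0 : 0 < s := lt_of_lt_of_le (by positivity) hs
  obtain ⟨g, hg, hgE⟩ := aux_psi_eq hΦ hs0.le
  rw [hgE]
  set q := s / (2 * c) with hq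
  have hqpos : 0 < q := by positivity
  have hqF : F ^ (n / k) ≤ q := by
    rw [hq, le_div_iff₀ (by positivity)]; linarith
  set M := q ^ (k / n) with hM
  set R := q ^ (1 / (2 * n)) with hR
  have hMpos : 0 < M := by positivity
  have hRpos : 0 < R := by positivity
  have hMF : F ≤ M := by
    have := Real.rpow_le_rpow (by positivity) hqF (show 0 ≤ k / n by positivity)
    rwa [← Real.rpow_mul hF.le, show n / k * (k / n) = 1 by field_simp, Real.rpow_one] at this
  have hR2 : R ^ 2 = q ^ (1 / n) := by
    rw [hR, ← Real.rpow_natCast, ← Real.rpow_mul hqpos.le]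
    congr 1; push_cast; field_simp
  have hMk : M ^ (1 / k) = q ^ (1 / n) := by
    rw [hM, ← Real.rpow_mul hqpos.le]
    congr 1; field_simp
  have hMR : M * R ^ 3 = q := by
    rw [hM, hR, ← Real.rpow_natCast, ← Real.rpow_mul hqpos.le, ← Real.rpow_add hqpos]
    conv_rhs => rw [← Real.rpow_one q]
    congr 1; push_cast; field_simp; rw [hn]; ring
  set D := q ^ (1 / n) with hD
  have hDpos : 0 < D := by positivity
  have key : ∀ v : R3, g v ≤ (Metric.closedBall (0:R3) R).indicator (fun _ => M) v +
      (K / D) * ((1/2) * ‖v‖ ^ 2 * g v + Φ (g v)) := by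
    intro v
    have hg0 := hg.1 v
    have hp0 := hΦ.nonneg _ hg0
    have hE0 := aux_nonneg hΦ hg v
    have hI0 : 0 ≤ (Metric.closedBall (0:R3) R).indicator (fun _ => M) v :=
      indicator_nonneg (fun _ _ => hMpos.le) v
    have hKD : (K / D) * ((1/2) * ‖v‖ ^ 2 * g v + Φ (g v)) =
        (2 / D) * ((1/2) * ‖v‖ ^ 2 * g v + Φ (g v)) +
        (1 / (C * D)) * ((1/2) * ‖v‖ ^ 2 * g v + Φ (g v)) := by
      rw [hK]; field_simp
    have hA : 0 ≤ (2 / D) * ((1/2) * ‖v‖ ^ 2 * g v + Φ (g v)) := by positivity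
    have hB : 0 ≤ (1 / (C * D)) * ((1/2) * ‖v‖ ^ 2 * g v + Φ (g v)) := by positivity
    rw [hKD]
    by_cases hv : v ∈ Metric.closedBall (0:R3) R
    · by_cases hgM : g v ≤ M
      · rw [indicator_of_mem hv]; linarith
      · push Not at hgM
        have hgpos : 0 < g v := by linarith
        have h1 := hgr (g v) (by linarith)
        rw [Real.rpow_add hgpos, Real.rpow_one] at h1
        have h2 : D ≤ g v ^ (1 / k) := by
          rw [← hMk]; exact Real.rpow_le_rpow hMpos.le hgM.le (by positivity)
        have h3 : g v * (C * D) ≤ Φ (g v) := by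
          refine le_trans ?_ h1
          have := mul_le_mul_of_nonneg_left h2 (show 0 ≤ C * g v by positivity)
          linarith
        have h4 : g v ≤ (1 / (C * D)) * ((1/2) * ‖v‖ ^ 2 * g v + Φ (g v)) := by
          rw [div_mul_eq_mul_div, one_mul, le_div_iff₀ (by positivity)]
          have : 0 ≤ (1/2) * ‖v‖ ^ 2 * g v := by positivity
          linarith
        linarith
    · have hv' : R < ‖v‖ := by simpa using hv
      have h2 : D ≤ ‖v‖ ^ 2 := by rw [← hR2]; gcongr
      have h4 : g v ≤ (2 / D) * ((1/2) * ‖v‖ ^ 2 * g v + Φ (g v)) := by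
        rw [div_mul_eq_mul_div, le_div_iff₀ (by positivity)]
        have := mul_le_mul_of_nonneg_left h2 hg0
        linarith
      linarith
  have hi := integral_mono hg.2.1 ((aux_int_ball R M).add (hg.2.2.2.const_mul (K / D))) key
  simp only [Pi.add_apply] at hi
  rw [integral_add (aux_int_ball R M) (hg.2.2.2.const_mul (K / D)), integral_const_mul,
    aux_integral_ball R M hRpos.le, hg.2.2.1, ← hc, ← mul_assoc, hMR] at hi
  change s ≤ q * c + K / D * En Φ g at hi
  have hqc : q * c = s / 2 := by rw [hq]; field_simp
  rw [hqc] at hi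
  have hfin : s / 2 * D / K ≤ En Φ g := by
    rw [div_le_iff₀ hKpos]
    have h5 : s / 2 ≤ K * En Φ g / D := by
      have : K / D * En Φ g = K * En Φ g / D := by ring
      linarith
    rw [le_div_iff₀ hDpos] at h5
    linarith
  refine le_trans (le_of_eq ?_) hfin
  rw [Real.rpow_add hs0, Real.rpow_one, hD, hq, div_eq_mul_one_div s (2 * c),
    Real.mul_rpow hs0.le (by positivity)]
  field_simp

theorem aux_upper {Φ Φ' : ℝ → ℝ} {k k' : ℝ} (hΦ : IsPhi Φ Φ' k k') :
    ∃ c₂ > 0, ∃ s₂ > 0, ∀ s, 0 ≤ s → s ≤ s₂ →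
      PsiOf Φ s ≤ c₂ * s ^ (1 + 1/(k' + 3/2)) := by
  obtain ⟨C, hC, F, hF, hgr⟩ := hΦ.growth_small
  have hk := hΦ.k'_pos
  set c := volume.real (Metric.closedBall (0:R3) 1) with hc
  have hcpos : 0 < c := aux_ball_pos
  set n := k' + 3/2 with hn
  have hnpos : 0 < n := by positivity
  refine ⟨(1/2 + C) * (1 / c) ^ (1/n), by positivity, c * F ^ (n / k'), by positivity, ?_⟩
  intro s hs0 hs
  set q := s / c with hq
  have hq0 : 0 ≤ q := by positivity
  have hqF : q ≤ F ^ (n / k') := by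
    rw [hq, div_le_iff₀ (by positivity)]; linarith
  set M := q ^ (k' / n) with hM
  set R := q ^ (1 / (2 * n)) with hR
  have hM0 : 0 ≤ M := by positivity
  have hR0 : 0 ≤ R := by positivity
  have hMF : M ≤ F := by
    have := Real.rpow_le_rpow hq0 hqF (show 0 ≤ k' / n by positivity)
    rwa [← Real.rpow_mul hF.le, show n / k' * (k' / n) = 1 by field_simp, Real.rpow_one] at this
  have hR2 : R ^ 2 = q ^ (1 / n) := by
    rw [hR, ← Real.rpow_natCast, ← Real.rpow_mul hq0]
    congr 1; push_cast; field_simp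
  have hMk : M ^ (1 / k') = q ^ (1 / n) := by
    rw [hM, ← Real.rpow_mul hq0]
    congr 1; field_simp
  have hMR : M * R ^ 3 = q := by
    rw [hM, hR, ← Real.rpow_natCast, ← Real.rpow_mul hq0,
      ← Real.rpow_add_of_nonneg hq0 (by positivity) (by positivity)]
    conv_rhs => rw [← Real.rpow_one q]
    congr 1; push_cast; field_simp; rw [hn]; ring
  set D := q ^ (1 / n) with hD
  have hD0 : 0 ≤ D := by positivity
  have hΦM : Φ M ≤ C * D * M := by
    have := hgr M hM0 hMF
    rw [Real.rpow_add_of_nonneg hM0 zero_le_one (by positivity), Real.rpow_one, hMk] at this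
    linarith
  have hmass : ∫ v, (Metric.closedBall (0:R3) R).indicator (fun _ => M) v = s := by
    rw [aux_integral_ball R M hR0, ← hc, ← mul_assoc, hMR, hq]; field_simp
  have hb0 : ∀ v, 0 ≤ (Metric.closedBall (0:R3) R).indicator (fun _ => M) v :=
    fun v => indicator_nonneg (fun _ _ => hM0) v
  have key : ∀ v : R3,
      (1/2) * ‖v‖ ^ 2 * (Metric.closedBall (0:R3) R).indicator (fun _ => M) v +
      Φ ((Metric.closedBall (0:R3) R).indicator (fun _ => M) v) ≤
      ((1/2 + C) * D) * (Metric.closedBall (0:R3) R).indicator (fun _ => M) v := by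
    intro v
    by_cases hv : v ∈ Metric.closedBall (0:R3) R
    · rw [indicator_of_mem hv]
      have hv' : ‖v‖ ≤ R := by simpa using hv
      have h2 : ‖v‖ ^ 2 ≤ D := by rw [← hR2]; gcongr
      have := mul_le_mul_of_nonneg_right h2 hM0
      linarith
    · rw [indicator_of_notMem hv, hΦ.zero]; simp
  have hi := aux_int_ball R M
  have hE : Integrable (fun v : R3 =>
      (1/2) * ‖v‖ ^ 2 * (Metric.closedBall (0:R3) R).indicator (fun _ => M) v +
      Φ ((Metric.closedBall (0:R3) R).indicator (fun _ => M) v)) := by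
    refine (hi.const_mul ((1/2 + C) * D)).mono' ?_ (Eventually.of_forall fun v => ?_)
    · refine AEStronglyMeasurable.add ?_ ?_
      · exact (by fun_prop : Continuous fun v : R3 => (1/2) * ‖v‖ ^ 2).aestronglyMeasurable.mul
          hi.aestronglyMeasurable
      · refine ((aux_contMax hΦ).comp_aestronglyMeasurable hi.aestronglyMeasurable).congr
          (Eventually.of_forall fun v => ?_)
        simp only [Function.comp_apply, max_eq_right (hb0 v)]
    · rw [Real.norm_of_nonneg]
      · exact key v
      · have h1 := hb0 v
        have h2 := hΦ.nonneg _ h1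
        positivity
  refine (aux_psi_le hΦ (g := (Metric.closedBall (0:R3) R).indicator (fun _ => M))
    ⟨hb0, hi, hmass, hE⟩).trans ?_
  have hfin := integral_mono hE (hi.const_mul ((1/2 + C) * D)) key
  rw [integral_const_mul, hmass] at hfin
  refine le_trans hfin (le_of_eq ?_)
  rw [Real.rpow_add_of_nonneg hs0 zero_le_one (by positivity), Real.rpow_one, hD, hq,
    div_eq_mul_one_div s c, Real.mul_rpow hs0 (by positivity)]
  ring

/-- the reduced function `Ψ` obtained from `Φ` is strictly convex and
satisfies the growth conditions (Ψ2), (Ψ3) with exponents `n = k + 3/2`, `n' = k' + 3/2`. -/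
theorem psiOf_properties
    (Φ Φ' : ℝ → ℝ) (k k' : ℝ) (hΦ : IsPhi Φ Φ' k k') :
    StrictConvexOn ℝ (Ici 0) (PsiOf Φ) ∧
    (0 < k + 3/2 ∧ k + 3/2 < 3) ∧ (0 < k' + 3/2 ∧ k' + 3/2 < 3) ∧
    (∃ c₁ > 0, ∃ s₁ > 0, ∀ s, s₁ ≤ s → c₁ * s ^ (1 + 1/(k + 3/2)) ≤ PsiOf Φ s) ∧
    (∃ c₂ > 0, ∃ s₂ > 0, ∀ s, 0 ≤ s → s ≤ s₂ → PsiOf Φ s ≤ c₂ * s ^ (1 + 1/(k' + 3/2))) := by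
  have h1 := hΦ.k_pos
  have h2 := hΦ.k_lt
  have h3 := hΦ.k'_pos
  have h4 := hΦ.k'_lt
  exact ⟨aux_strictConvex hΦ, ⟨by linarith, by linarith⟩, ⟨by linarith, by linarith⟩,
    aux_lower hΦ, aux_upper hΦ⟩
end
end

section
/- Let M > 0 and let Ψ satisfy (Ψ1)–(Ψ3). Then there exists a constant C > 0, depending only on M and Ψ, such that for every ρ ∈ R_M one has H_r(ρ) ≥ ∫ Ψ(ρ) dx - C - C (∫ Ψ(ρ) dx)^{n/3}. Consequently, since n < 3, the reduced functional H_r is bounded from below on R_M, i.e. h_M := inf_{R_M} H_r > -∞, and along any minimizing sequence (ρ_j) ⊂ R_M the quantities ∫ Ψ(ρ_j) dx and the norms ‖ρ_j‖_{1+1/n} are bounded. -/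
open MeasureTheory Filter Topology Set ENNReal

noncomputable section

/-- Newtonian kernel as an extended nonnegative function. -/
def kerN (z : R3) : ℝ≥0∞ := ENNReal.ofReal (‖z‖⁻¹)

lemma kerN_meas : Measurable kerN := by
  unfold kerN; fun_prop

lemma kerN_neg (z : R3) : kerN (-z) = kerN z := by simp [kerN]

lemma ball_kernel : ∃ c : ℝ, 0 ≤ c ∧ ∀ R : ℝ, 0 < R →
    ∫⁻ z : R3, (if ‖z‖ < R then kerN z else 0) ≤ ENNReal.ofReal (c * R ^ 2) := by
  refine ⟨3 * (volume : Measure R3).real (Metric.ball 0 1), by positivity, fun R hR => ?_⟩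
  set f : ℝ → ℝ := fun y => if y < R then y⁻¹ else 0 with hf
  have hd : Module.finrank ℝ R3 = 3 := by simp
  have e : EqOn (fun y : ℝ => y ^ (Module.finrank ℝ R3 - 1) • f y)
      ((Ioo 0 R).indicator (fun y => y)) (Ioi 0) := by
    intro y hy
    have hy : 0 < y := hy
    rw [hd]
    by_cases h : y < R
    · simp [hf, h, hy]; field_simp
    · simp [hf, h]
  have i1 : IntegrableOn (fun y : ℝ => y) (Ioo 0 R) :=
    (continuous_id.integrableOn_Icc (a := 0) (b := R)).mono_set Ioo_subset_Icc_self
  have i2 : Integrable ((Ioo 0 R).indicator (fun y : ℝ => y)) :=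
    i1.integrable_indicator measurableSet_Ioo
  have hint : Integrable (fun z : R3 => f ‖z‖) := by
    rw [integrable_fun_norm_addHaar, integrableOn_congr_fun e measurableSet_Ioi]
    exact i2.integrableOn
  have hpos : ∀ z : R3, 0 ≤ f ‖z‖ := by
    intro z; simp only [hf]; split_ifs <;> positivity
  have hval := integral_fun_norm_addHaar (volume : Measure R3) f
  rw [setIntegral_congr_fun measurableSet_Ioi e] at hval
  have hle : ∫ y in Ioi (0:ℝ), (Ioo 0 R).indicator (fun y : ℝ => y) y ≤ R ^ 2 := by
    calc _ ≤ ∫ y : ℝ, (Ioo 0 R).indicator (fun y : ℝ => y) y := by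
            refine setIntegral_le_integral i2 (.of_forall fun y => ?_)
            exact indicator_nonneg (fun y hy => hy.1.le) y
      _ = ∫ y in Ioo 0 R, y := integral_indicator measurableSet_Ioo
      _ ≤ ∫ y in Ioo 0 R, R := by
            refine setIntegral_mono_on i1 (by simp) measurableSet_Ioo fun y hy => hy.2.le
      _ = R ^ 2 := by simp [hR.le]; ring
  calc _ = ∫⁻ z : R3, ENNReal.ofReal (f ‖z‖) := by
          refine lintegral_congr fun z => ?_
          simp only [hf, kerN]; split_ifs <;> simp
    _ = ENNReal.ofReal (∫ z : R3, f ‖z‖) :=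
          (ofReal_integral_eq_lintegral_ofReal hint (.of_forall hpos)).symm
    _ ≤ _ := by
          apply ENNReal.ofReal_le_ofReal
          rw [hval, hd]
          simp only [nsmul_eq_mul, smul_eq_mul]
          push_cast
          rw [mul_assoc]
          gcongr

lemma inner_bound {c : ℝ} (hc : 0 ≤ c) (hck : ∀ R : ℝ, 0 < R →
    ∫⁻ z : R3, (if ‖z‖ < R then kerN z else 0) ≤ ENNReal.ofReal (c * R ^ 2))
    {M : ℝ} (hM : 0 < M) {f : R3 → ℝ≥0∞} (hf : Measurable f)
    (hfM : ∫⁻ y, f y = ENNReal.ofReal M) {a : ℝ} (ha : 0 < a) (x : R3) :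
    ∫⁻ y, min (f y) (ENNReal.ofReal a) * kerN (x - y) ≤
      ENNReal.ofReal ((c + 1) * M ^ (2/3 : ℝ) * a ^ (1/3 : ℝ)) := by
  set R : ℝ := (M / a) ^ (1/3 : ℝ) with hRdef
  have hR : 0 < R := by positivity
  have hpt : ∀ y, min (f y) (ENNReal.ofReal a) * kerN (x - y) ≤
      ENNReal.ofReal a * (if ‖x - y‖ < R then kerN (x - y) else 0) +
        f y * ENNReal.ofReal R⁻¹ := by
    intro y
    by_cases h : ‖x - y‖ < R
    · rw [if_pos h]
      refine le_add_of_le_left ?_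
      gcongr
      exact min_le_right _ _
    · rw [if_neg h, mul_zero, zero_add]
      unfold kerN
      gcongr
      · exact min_le_left _ _
      · exact not_lt.mp h
  have hk : Measurable fun z : R3 => if ‖z‖ < R then kerN z else 0 :=
    Measurable.ite (measurableSet_lt measurable_norm measurable_const) kerN_meas measurable_const
  calc _ ≤ ∫⁻ y, (ENNReal.ofReal a * (if ‖x - y‖ < R then kerN (x - y) else 0) +
        f y * ENNReal.ofReal R⁻¹) := lintegral_mono hpt
    _ = ENNReal.ofReal a * (∫⁻ z : R3, (if ‖z‖ < R then kerN z else 0)) +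
        ENNReal.ofReal M * ENNReal.ofReal R⁻¹ := by
      rw [lintegral_add_right _ (by fun_prop), lintegral_mul_const _ hf, hfM,
        lintegral_const_mul' _ _ ENNReal.ofReal_ne_top,
        lintegral_sub_left_eq_self (fun z : R3 => if ‖z‖ < R then kerN z else 0) x]
    _ ≤ ENNReal.ofReal a * ENNReal.ofReal (c * R ^ 2) +
        ENNReal.ofReal M * ENNReal.ofReal R⁻¹ := by
      gcongr; exact hck R hR
    _ = ENNReal.ofReal (a * (c * R ^ 2) + M * R⁻¹) := by
      rw [← ENNReal.ofReal_mul ha.le, ← ENNReal.ofReal_mul hM.le, ENNReal.ofReal_add] <;> positivity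
    _ = _ := by
      congr 1
      have hR3 : R ^ 3 = M / a := by
        rw [hRdef, ← Real.rpow_natCast, ← Real.rpow_mul (by positivity)]; norm_num
      have hM' : M = a * R ^ 3 := by rw [hR3]; field_simp
      have h1 : M ^ (2/3 : ℝ) = a ^ (2/3 : ℝ) * R ^ 2 := by
        rw [hM', Real.mul_rpow ha.le (by positivity), ← Real.rpow_natCast R 3,
          ← Real.rpow_mul hR.le, ← Real.rpow_natCast R 2]; norm_num
      have h2 : a ^ (2/3 : ℝ) * a ^ (1/3 : ℝ) = a := by
        rw [← Real.rpow_add ha]; norm_num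
      rw [h1]
      have h3 : M * R⁻¹ = a * R ^ 2 := by rw [hM']; field_simp
      rw [h3]
      linear_combination (-(c + 1) * R ^ 2) * h2

lemma double_bound {c : ℝ} (hc : 0 ≤ c) (hck : ∀ R : ℝ, 0 < R →
    ∫⁻ z : R3, (if ‖z‖ < R then kerN z else 0) ≤ ENNReal.ofReal (c * R ^ 2))
    {M : ℝ} (hM : 0 < M) {f : R3 → ℝ≥0∞} (hf : Measurable f) (hft : ∀ x, f x ≠ ⊤)
    (hfM : ∫⁻ y, f y = ENNReal.ofReal M) :
    ∫⁻ x, ∫⁻ y, f x * f y * kerN (x - y) ≤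
      2 * (ENNReal.ofReal ((c + 1) * M ^ (2/3 : ℝ)) * ∫⁻ x, f x ^ (4/3 : ℝ)) := by
  have hkm := kerN_meas
  set g : R3 → R3 → ℝ≥0∞ := fun x y => f x * (min (f y) (f x) * kerN (x - y)) with hg
  have hgm : Measurable (Function.uncurry g) := by
    simp only [hg, Function.uncurry_def]; fun_prop
  have hgm' : Measurable (Function.uncurry (fun x y => g y x)) := hgm.comp measurable_swap
  have hpt : ∀ x y, f x * f y * kerN (x - y) ≤ g x y + g y x := by
    intro x y
    have hk : kerN (y - x) = kerN (x - y) := by rw [← kerN_neg, neg_sub]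
    simp only [hg, hk]
    rcases le_total (f x) (f y) with h | h
    · refine le_add_of_le_right (le_of_eq ?_)
      rw [min_eq_left h]; ring
    · refine le_add_of_le_left (le_of_eq ?_)
      rw [min_eq_left h]; ring
  have hin : ∫⁻ x, ∫⁻ y, g x y ≤
      ENNReal.ofReal ((c + 1) * M ^ (2/3 : ℝ)) * ∫⁻ x, f x ^ (4/3 : ℝ) := by
    rw [← lintegral_const_mul' _ _ ENNReal.ofReal_ne_top]
    refine lintegral_mono fun x => ?_
    simp only [hg]
    rw [lintegral_const_mul' _ _ (hft x)]
    rcases eq_or_ne (f x) 0 with h0 | h0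
    · simp [h0]
    have ha : 0 < (f x).toReal := ENNReal.toReal_pos h0 (hft x)
    have he : f x = ENNReal.ofReal (f x).toReal := (ENNReal.ofReal_toReal (hft x)).symm
    have := inner_bound hc hck hM hf hfM ha x
    rw [← he] at this
    calc _ ≤ f x * ENNReal.ofReal ((c + 1) * M ^ (2/3 : ℝ) * (f x).toReal ^ (1/3 : ℝ)) := by
          gcongr
      _ = ENNReal.ofReal ((c + 1) * M ^ (2/3 : ℝ)) * (f x ^ (1 : ℝ) * f x ^ (1/3 : ℝ)) := by
          rw [ENNReal.ofReal_mul (by positivity), ← ENNReal.ofReal_rpow_of_pos ha, ← he,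
            ENNReal.rpow_one]; ring
      _ = _ := by rw [← ENNReal.rpow_add _ _ h0 (hft x)]; norm_num
  calc _ ≤ ∫⁻ x, ∫⁻ y, (g x y + g y x) := lintegral_mono fun x => lintegral_mono (hpt x)
    _ = ∫⁻ x, ((∫⁻ y, g x y) + ∫⁻ y, g y x) := by
        refine lintegral_congr fun x => ?_
        rw [lintegral_add_left]
        exact hgm.of_uncurry_left
    _ = (∫⁻ x, ∫⁻ y, g x y) + ∫⁻ x, ∫⁻ y, g y x := by
        rw [lintegral_add_left]
        exact hgm.lintegral_prod_right
    _ = 2 * ∫⁻ x, ∫⁻ y, g x y := by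
        rw [lintegral_lintegral_swap (f := fun x y => g y x) hgm'.aemeasurable, two_mul]
    _ ≤ _ := by gcongr

/-- `|D(ρ)| ≤ C M^{2/3} ∫ ρ^{4/3}`. -/
lemma Dpair_bound : ∃ A : ℝ, 0 < A ∧ ∀ (M : ℝ), 0 < M → ∀ ρ : R3 → ℝ, (∀ x, 0 ≤ ρ x) →
    Integrable ρ → (∫ x, ρ x) = M →
    ENNReal.ofReal (Dpair ρ) ≤
      ENNReal.ofReal (A * M ^ (2/3 : ℝ)) * ∫⁻ x, ENNReal.ofReal (ρ x) ^ (4/3 : ℝ) := by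
  obtain ⟨c, hc, hck⟩ := ball_kernel
  refine ⟨2 * (c + 1), by positivity, fun M hM ρ h0 hi hm => ?_⟩
  have hae := hi.aestronglyMeasurable.aemeasurable
  set f : R3 → ℝ≥0∞ := fun x => ENNReal.ofReal (hae.mk ρ x) with hf
  have hfm : Measurable f := hae.measurable_mk.ennreal_ofReal
  have hfe : (fun x => ENNReal.ofReal (ρ x)) =ᵐ[volume] f := by
    filter_upwards [hae.ae_eq_mk] with x hx
    simp only [hf, ← hx]
  have hfM : ∫⁻ y, f y = ENNReal.ofReal M := by
    rw [← lintegral_congr_ae hfe, ← hm, ofReal_integral_eq_lintegral_ofReal hi (.of_forall h0)]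
  have key := double_bound hc hck hM hfm (fun x => ENNReal.ofReal_ne_top) hfM
  have h43 : ∫⁻ x, f x ^ (4/3 : ℝ) = ∫⁻ x, ENNReal.ofReal (ρ x) ^ (4/3 : ℝ) := by
    refine lintegral_congr_ae ?_
    filter_upwards [hfe] with x hx
    rw [← hx]
  have hdd : ∫⁻ x, ∫⁻ y, ENNReal.ofReal (ρ x) * ENNReal.ofReal (ρ y) * kerN (x - y) =
      ∫⁻ x, ∫⁻ y, f x * f y * kerN (x - y) := by
    refine lintegral_congr_ae ?_
    filter_upwards [hfe] with x hx
    refine lintegral_congr_ae ?_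
    filter_upwards [hfe] with y hy
    rw [← hx, ← hy]
  calc ENNReal.ofReal (Dpair ρ) ≤ ‖Dpair ρ‖ₑ := Real.ofReal_le_enorm _
    _ ≤ ∫⁻ x, ‖∫ y, ρ x * ρ y / ‖x - y‖‖ₑ := enorm_integral_le_lintegral_enorm _
    _ ≤ ∫⁻ x, ∫⁻ y, ‖ρ x * ρ y / ‖x - y‖‖ₑ :=
        lintegral_mono fun x => enorm_integral_le_lintegral_enorm _
    _ = ∫⁻ x, ∫⁻ y, ENNReal.ofReal (ρ x) * ENNReal.ofReal (ρ y) * kerN (x - y) := by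
        refine lintegral_congr fun x => lintegral_congr fun y => ?_
        have := h0 x
        have := h0 y
        rw [Real.enorm_of_nonneg (by positivity), div_eq_mul_inv,
          ENNReal.ofReal_mul (by positivity), ENNReal.ofReal_mul (h0 x), kerN]
    _ ≤ _ := hdd.trans_le key
    _ = _ := by
        rw [h43, mul_assoc 2 (c + 1), ENNReal.ofReal_mul zero_le_two, mul_assoc]
        simp

lemma lint_rho {Ψ : ℝ → ℝ} {M : ℝ} {ρ : R3 → ℝ} (h : MemRM Ψ M ρ) :
    ∫⁻ x, ENNReal.ofReal (ρ x) = ENNReal.ofReal M := by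
  rw [← h.mass, ofReal_integral_eq_lintegral_ofReal h.integrable (.of_forall h.nonneg)]

lemma lint_psi {Ψ Ψ' : ℝ → ℝ} {n n' : ℝ} (hΨ : IsPsi Ψ Ψ' n n') {M : ℝ} {ρ : R3 → ℝ}
    (h : MemRM Ψ M ρ) :
    ∫⁻ x, ENNReal.ofReal (Ψ (ρ x)) = ENNReal.ofReal (∫ x, Ψ (ρ x)) := by
  rw [ofReal_integral_eq_lintegral_ofReal h.psi_int
    (.of_forall fun x => hΨ.nonneg _ (h.nonneg x))]

lemma int_psi_nonneg {Ψ Ψ' : ℝ → ℝ} {n n' : ℝ} (hΨ : IsPsi Ψ Ψ' n n') {M : ℝ} {ρ : R3 → ℝ}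
    (h : MemRM Ψ M ρ) : 0 ≤ ∫ x, Ψ (ρ x) :=
  integral_nonneg fun x => hΨ.nonneg _ (h.nonneg x)

lemma rpow43_bound {Ψ Ψ' : ℝ → ℝ} {n n' : ℝ} (hΨ : IsPsi Ψ Ψ' n n') :
    ∃ a b : ℝ, 0 < a ∧ 0 < b ∧ ∀ s, 0 ≤ s →
      s ^ (4/3 : ℝ) ≤ a * s + b * (s ^ (1 - n/3) * Ψ s ^ (n/3)) := by
  obtain ⟨C, hC, s₁, hs₁, hg⟩ := hΨ.growth_large
  have hn := hΨ.n_pos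
  refine ⟨s₁ ^ (1/3 : ℝ), (C ^ (n/3))⁻¹, by positivity, by positivity, fun s hs => ?_⟩
  have hΨs := hΨ.nonneg s hs
  rcases le_total s₁ s with h | h
  · have hs0 : 0 < s := hs₁.trans_le h
    have h1 : (C * s ^ (1 + 1/n)) ^ (n/3) ≤ Ψ s ^ (n/3) :=
      Real.rpow_le_rpow (by positivity) (hg s h) (by positivity)
    rw [Real.mul_rpow hC.le (by positivity), ← Real.rpow_mul hs] at h1
    have h2 : s ^ (4/3 : ℝ) = s ^ (1 - n/3) * s ^ ((1 + 1/n) * (n/3)) := by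
      rw [← Real.rpow_add hs0]; congr 1; field_simp; ring
    have h3 : s ^ ((1 + 1/n) * (n/3)) ≤ (C ^ (n/3))⁻¹ * Ψ s ^ (n/3) := by
      rw [inv_mul_eq_div, le_div_iff₀ (by positivity), mul_comm]; exact h1
    calc s ^ (4/3 : ℝ) = s ^ (1 - n/3) * s ^ ((1 + 1/n) * (n/3)) := h2
      _ ≤ s ^ (1 - n/3) * ((C ^ (n/3))⁻¹ * Ψ s ^ (n/3)) := by gcongr
      _ = (C ^ (n/3))⁻¹ * (s ^ (1 - n/3) * Ψ s ^ (n/3)) := by ring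
      _ ≤ _ := le_add_of_nonneg_left (by positivity)
  · have h1 : s ^ (4/3 : ℝ) = s ^ (1/3 : ℝ) * s := by
      rcases hs.eq_or_lt with rfl | h0
      · norm_num
      · nth_rewrite 3 [← Real.rpow_one s]
        rw [← Real.rpow_add h0]; norm_num
    rw [h1]
    refine le_add_of_le_of_nonneg ?_ (by positivity)
    gcongr

lemma lint43 {Ψ Ψ' : ℝ → ℝ} {n n' : ℝ} (hΨ : IsPsi Ψ Ψ' n n') {M : ℝ} (hM : 0 < M) :
    ∃ a b : ℝ, 0 < a ∧ 0 < b ∧ ∀ ρ, MemRM Ψ M ρ →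
      ∫⁻ x, ENNReal.ofReal (ρ x) ^ (4/3 : ℝ) ≤
        ENNReal.ofReal (a + b * (∫ x, Ψ (ρ x)) ^ (n/3)) := by
  obtain ⟨a, b, ha, hb, hab⟩ := rpow43_bound hΨ
  have hn := hΨ.n_pos
  have hn3 := hΨ.n_lt
  refine ⟨a * M, b * M ^ (1 - n/3), by positivity, by positivity, fun ρ h => ?_⟩
  have hI := int_psi_nonneg hΨ h
  have m1 : AEMeasurable (fun x => ENNReal.ofReal (ρ x)) :=
    h.integrable.aestronglyMeasurable.aemeasurable.ennreal_ofReal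
  have m2 : AEMeasurable (fun x => ENNReal.ofReal (Ψ (ρ x))) :=
    h.psi_int.aestronglyMeasurable.aemeasurable.ennreal_ofReal
  have hp : 0 ≤ 1 - n/3 := by linarith
  have hq : 0 ≤ n/3 := by linarith
  calc _ ≤ ∫⁻ x, (ENNReal.ofReal a * ENNReal.ofReal (ρ x) + ENNReal.ofReal b *
          (ENNReal.ofReal (ρ x) ^ (1 - n/3) * ENNReal.ofReal (Ψ (ρ x)) ^ (n/3))) := by
        refine lintegral_mono fun x => ?_
        have h0 := h.nonneg x
        have h1 := hΨ.nonneg _ h0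
        simp only
        rw [ENNReal.ofReal_rpow_of_nonneg h0 (by norm_num), ENNReal.ofReal_rpow_of_nonneg h0 hp,
          ENNReal.ofReal_rpow_of_nonneg h1 hq, ← ENNReal.ofReal_mul (by positivity),
          ← ENNReal.ofReal_mul (by positivity), ← ENNReal.ofReal_mul (by positivity),
          ← ENNReal.ofReal_add (by positivity) (by positivity)]
        exact ENNReal.ofReal_le_ofReal (hab _ h0)
    _ = ENNReal.ofReal a * ENNReal.ofReal M + ENNReal.ofReal b *
          ∫⁻ x, (ENNReal.ofReal (ρ x) ^ (1 - n/3) * ENNReal.ofReal (Ψ (ρ x)) ^ (n/3)) := by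
        rw [lintegral_add_left' (m1.const_mul _), lintegral_const_mul' _ _ ENNReal.ofReal_ne_top,
          lintegral_const_mul' _ _ ENNReal.ofReal_ne_top, lint_rho h]
    _ ≤ ENNReal.ofReal a * ENNReal.ofReal M + ENNReal.ofReal b *
          (ENNReal.ofReal M ^ (1 - n/3) * ENNReal.ofReal (∫ x, Ψ (ρ x)) ^ (n/3)) := by
        rw [← lint_rho h, ← lint_psi hΨ h]
        gcongr
        exact ENNReal.lintegral_mul_norm_pow_le m1 m2 hp hq (by ring)
    _ = _ := by
        rw [ENNReal.ofReal_rpow_of_nonneg hM.le hp, ENNReal.ofReal_rpow_of_nonneg hI hq,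
          ← ENNReal.ofReal_mul (by positivity), ← ENNReal.ofReal_mul (by positivity),
          ← ENNReal.ofReal_mul (by positivity),
          ← ENNReal.ofReal_add (by positivity) (by positivity), mul_assoc]

lemma lintp {Ψ Ψ' : ℝ → ℝ} {n n' : ℝ} (hΨ : IsPsi Ψ Ψ' n n') {M : ℝ} (hM : 0 < M) :
    ∃ a b : ℝ, 0 < a ∧ 0 < b ∧ ∀ ρ, MemRM Ψ M ρ →
      ∫⁻ x, ENNReal.ofReal (ρ x) ^ (1 + 1/n) ≤ ENNReal.ofReal (a + b * ∫ x, Ψ (ρ x)) := by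
  obtain ⟨C, hC, s₁, hs₁, hg⟩ := hΨ.growth_large
  have hn := hΨ.n_pos
  refine ⟨s₁ ^ (1/n) * M, C⁻¹, by positivity, by positivity, fun ρ h => ?_⟩
  have hI := int_psi_nonneg hΨ h
  have hpt : ∀ s, 0 ≤ s → s ^ (1 + 1/n) ≤ s₁ ^ (1/n) * s + C⁻¹ * Ψ s := by
    intro s hs
    have hΨs := hΨ.nonneg s hs
    rcases le_total s₁ s with h | h
    · refine le_add_of_nonneg_of_le (by positivity) ?_
      rw [inv_mul_eq_div, le_div_iff₀ hC, mul_comm]; exact hg s h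
    · refine le_add_of_le_of_nonneg ?_ (by positivity)
      rcases hs.eq_or_lt with rfl | h0
      · rw [Real.zero_rpow (by positivity)]; simp
      · rw [Real.rpow_add h0, Real.rpow_one, mul_comm]
        gcongr
  have m1 : AEMeasurable (fun x => ENNReal.ofReal (ρ x)) :=
    h.integrable.aestronglyMeasurable.aemeasurable.ennreal_ofReal
  calc _ ≤ ∫⁻ x, (ENNReal.ofReal (s₁ ^ (1/n)) * ENNReal.ofReal (ρ x) + ENNReal.ofReal C⁻¹ *
          ENNReal.ofReal (Ψ (ρ x))) := by
        refine lintegral_mono fun x => ?_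
        have h0 := h.nonneg x
        have h1 := hΨ.nonneg _ h0
        simp only
        rw [ENNReal.ofReal_rpow_of_nonneg h0 (by positivity), ← ENNReal.ofReal_mul (by positivity),
          ← ENNReal.ofReal_mul (by positivity),
          ← ENNReal.ofReal_add (by positivity) (by positivity)]
        exact ENNReal.ofReal_le_ofReal (hpt _ h0)
    _ = _ := by
        rw [lintegral_add_left' (m1.const_mul _), lintegral_const_mul' _ _ ENNReal.ofReal_ne_top,
          lintegral_const_mul' _ _ ENNReal.ofReal_ne_top, lint_rho h, lint_psi hΨ h,
          ← ENNReal.ofReal_mul (by positivity), ← ENNReal.ofReal_mul (by positivity),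
          ← ENNReal.ofReal_add (by positivity) (by positivity)]

lemma sublin {C θ : ℝ} (hC : 0 < C) (h0 : 0 < θ) (h1 : θ < 1) :
    ∃ K : ℝ, ∀ t, 0 ≤ t → C * t ^ θ ≤ t / 2 + K := by
  have h1' : 0 < 1 - θ := by linarith
  set T : ℝ := (2 * C) ^ (1 / (1 - θ)) with hT
  have hTpos : 0 < T := by positivity
  refine ⟨C * T ^ θ, fun t ht => ?_⟩
  rcases le_total T t with h | h
  · have htp : 0 < t := hTpos.trans_le h
    have h2 : 2 * C ≤ t ^ (1 - θ) := by
      have : T ^ (1 - θ) = 2 * C := by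
        rw [hT, ← Real.rpow_mul (by positivity), one_div, inv_mul_cancel₀ h1'.ne', Real.rpow_one]
      rw [← this]
      gcongr
    have h3 : t ^ (1 - θ) * t ^ θ = t := by
      rw [← Real.rpow_add htp]; norm_num
    have h4 : 2 * C * t ^ θ ≤ t := by
      calc _ ≤ t ^ (1 - θ) * t ^ θ := by gcongr
        _ = t := h3
    have : 0 ≤ C * T ^ θ := by positivity
    linarith
  · have : C * t ^ θ ≤ C * T ^ θ := by gcongr
    linarith

/-- lower bound `H_r(ρ) ≥ ∫Ψ(ρ) - C - C(∫Ψ(ρ))^{n/3}` on `R_M`;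
consequently `H_r` is bounded from below on `R_M` and along minimizing sequences
`∫Ψ(ρ_j)` and `‖ρ_j‖_{1+1/n}` are bounded. -/
theorem reduced_lower_bound
    (Ψ Ψ' : ℝ → ℝ) (n n' : ℝ) (hΨ : IsPsi Ψ Ψ' n n') (M : ℝ) (hM : 0 < M) :
    ∃ C > 0,
      (∀ ρ, MemRM Ψ M ρ →
        (∫ x, Ψ (ρ x)) - C - C * (∫ x, Ψ (ρ x)) ^ (n/3) ≤ Hr Ψ ρ) ∧
      BddBelow (Hr Ψ '' RMset Ψ M) ∧
      (∀ ρ : ℕ → R3 → ℝ, (∀ j, MemRM Ψ M (ρ j)) →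
        Tendsto (fun j => Hr Ψ (ρ j)) atTop (𝓝 (sInf (Hr Ψ '' RMset Ψ M))) →
        ∃ B : ℝ, ∀ j, (∫ x, Ψ (ρ j x)) ≤ B ∧
          eLpNorm (ρ j) (ENNReal.ofReal (1 + 1/n)) volume ≤ ENNReal.ofReal B) := by
  obtain ⟨A, hA, hD⟩ := Dpair_bound
  obtain ⟨a, b, ha, hb, hab⟩ := lint43 hΨ hM
  obtain ⟨a', b', ha', hb', hab'⟩ := lintp hΨ hM
  have hn := hΨ.n_pos
  have hn3 := hΨ.n_lt
  set Q : ℝ := A * M ^ (2/3 : ℝ) with hQ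
  have hQpos : 0 < Q := by positivity
  have hC : 0 < Q * (a + b) := by positivity
  have main : ∀ ρ, MemRM Ψ M ρ → (∫ x, Ψ (ρ x)) - Q * (a + b) -
      Q * (a + b) * (∫ x, Ψ (ρ x)) ^ (n/3) ≤ Hr Ψ ρ := by
    intro ρ h
    have hI := int_psi_nonneg hΨ h
    have h1 := hD M hM ρ h.nonneg h.integrable h.mass
    have h2 : ENNReal.ofReal (Dpair ρ) ≤
        ENNReal.ofReal (Q * (a + b * (∫ x, Ψ (ρ x)) ^ (n/3))) := by
      rw [ENNReal.ofReal_mul hQpos.le]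
      refine h1.trans ?_
      gcongr
      exact hab ρ h
    have h3 : Dpair ρ ≤ Q * (a + b * (∫ x, Ψ (ρ x)) ^ (n/3)) :=
      (ENNReal.ofReal_le_ofReal_iff (by positivity)).mp h2
    unfold Hr Epot
    set t := (∫ x, Ψ (ρ x)) ^ (n/3) with ht
    have ht0 : 0 ≤ t := by positivity
    have e1 : 0 ≤ Q * a := by positivity
    have e2 : 0 ≤ Q * b := by positivity
    have e3 : 0 ≤ Q * a * t := by positivity
    have e4 : 0 ≤ Q * b * t := by positivity
    nlinarith
  obtain ⟨K, hK⟩ := sublin hC (by positivity : 0 < n/3) (by linarith : n/3 < 1)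
  have low : ∀ ρ, MemRM Ψ M ρ → (∫ x, Ψ (ρ x)) / 2 - (Q * (a + b) + K) ≤ Hr Ψ ρ := by
    intro ρ h
    have := main ρ h
    have := hK _ (int_psi_nonneg hΨ h)
    linarith
  refine ⟨Q * (a + b), hC, main, ⟨-(Q * (a + b) + K), ?_⟩, ?_⟩
  · rintro _ ⟨ρ, h, rfl⟩
    have := low ρ h
    have := int_psi_nonneg hΨ h
    linarith
  · intro ρ h ht
    obtain ⟨B, hB⟩ := ht.bddAbove_range
    set B₁ : ℝ := 2 * (B + (Q * (a + b) + K)) with hB₁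
    have hb1 : ∀ j, (∫ x, Ψ (ρ j x)) ≤ B₁ := by
      intro j
      have h1 := low _ (h j)
      have h2 : Hr Ψ (ρ j) ≤ B := hB ⟨j, rfl⟩
      linarith
    have hB₁0 : 0 ≤ B₁ := (int_psi_nonneg hΨ (h 0)).trans (hb1 0)
    have hp : 0 < 1 + 1/n := by positivity
    set B₂ : ℝ := (a' + b' * B₁) ^ (1 / (1 + 1/n)) with hB₂
    refine ⟨max B₁ B₂, fun j => ⟨(hb1 j).trans (le_max_left _ _), ?_⟩⟩
    refine le_trans ?_ (ENNReal.ofReal_le_ofReal (le_max_right _ _))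
    rw [eLpNorm_eq_lintegral_rpow_enorm_toReal (by simpa using hp) ENNReal.ofReal_ne_top,
      ENNReal.toReal_ofReal hp.le, hB₂, ← ENNReal.ofReal_rpow_of_nonneg (by positivity)
        (by positivity)]
    refine ENNReal.rpow_le_rpow ?_ (by positivity)
    calc _ = ∫⁻ x, ENNReal.ofReal (ρ j x) ^ (1 + 1/n) := by
          refine lintegral_congr fun x => ?_
          rw [Real.enorm_of_nonneg ((h j).nonneg x)]
      _ ≤ _ := hab' _ (h j)
      _ ≤ _ := by
          apply ENNReal.ofReal_le_ofReal
          have := hb1 j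
          gcongr
end
end
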